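/- arXiv:1307.0483 — 3 statements merged into one kernel-verified Lean document; each statement's English description precedes it below -/
import Mathlib

section
/- Let A ∈ ℝ^{n×m} satisfy RIP(3s, 0.2). Then every s-sparse vector x ∈ ℝ^m is exactly recovered from its measurements b = Ax by basis pursuit: x is the unique minimizer of ‖z‖₁ over all z ∈ ℝ^m with Az = b. -/
/-- A vector `x ∈ ℝ^m` is `s`-sparse if at most `s` of its coordinates are nonzero. -/
def IsSparse {m : ℕ} (s : ℕ) (x : Fin m → ℝ) : Prop :=
  ({i | x i ≠ 0} : Set (Fin m)).ncard ≤ s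

/-- The Euclidean (`ℓ₂`) norm on `ℝ^m`. -/
noncomputable def l2norm {m : ℕ} (x : Fin m → ℝ) : ℝ :=
  Real.sqrt (∑ i, (x i) ^ 2)

/-- The `ℓ₁` norm on `ℝ^m`. -/
noncomputable def l1norm {m : ℕ} (x : Fin m → ℝ) : ℝ :=
  ∑ i, |x i|

/-- A matrix `A ∈ ℝ^{n×m}` satisfies `RIP(s, δ)` if
`(1−δ)‖x‖₂ ≤ ‖Ax‖₂ ≤ (1+δ)‖x‖₂` for every `s`-sparse `x ∈ ℝ^m`. -/
def RIP {n m : ℕ} (A : Matrix (Fin n) (Fin m) ℝ) (s : ℕ) (δ : ℝ) : Prop :=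
  ∀ x : Fin m → ℝ, IsSparse s x →
    (1 - δ) * l2norm x ≤ l2norm (A.mulVec x) ∧
    l2norm (A.mulVec x) ≤ (1 + δ) * l2norm x

noncomputable def restr {m : ℕ} (T : Finset (Fin m)) (h : Fin m → ℝ) : Fin m → ℝ :=
  fun i => if i ∈ T then h i else 0

lemma l2norm_add_le {m : ℕ} (u v : Fin m → ℝ) : l2norm (u + v) ≤ l2norm u + l2norm v := by
  have key : ∀ w : Fin m → ℝ, l2norm w = ‖(WithLp.toLp 2 w : EuclideanSpace ℝ (Fin m))‖ := by
    intro w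
    rw [EuclideanSpace.norm_eq]
    simp [l2norm]
  rw [key, key, key, WithLp.toLp_add]
  exact norm_add_le _ _

lemma l2norm_neg' {m : ℕ} (u : Fin m → ℝ) : l2norm (-u) = l2norm u := by
  simp [l2norm]

lemma l2norm_nonneg' {m : ℕ} (u : Fin m → ℝ) : 0 ≤ l2norm u := Real.sqrt_nonneg _

lemma l2norm_restr_sq {m : ℕ} (T : Finset (Fin m)) (h : Fin m → ℝ) :
    l2norm (restr T h) ^ 2 = ∑ i ∈ T, (h i) ^ 2 := by
  rw [l2norm, Real.sq_sqrt (Finset.sum_nonneg fun i _ => sq_nonneg _)]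
  simp [restr, ite_pow, Finset.sum_ite_mem]

lemma restr_sparse {m : ℕ} (T : Finset (Fin m)) (h : Fin m → ℝ) {k : ℕ} (hk : T.card ≤ k) :
    IsSparse k (restr T h) := by
  unfold IsSparse
  refine le_trans ?_ hk
  rw [← Set.ncard_coe_finset]
  apply Set.ncard_le_ncard _ (Finset.finite_toSet T)
  intro i hi
  by_contra hc
  apply hi
  have : i ∉ T := by simpa using hc
  simp [restr, this]

lemma restr_union {m : ℕ} (T U : Finset (Fin m)) (hd : Disjoint T U) (h : Fin m → ℝ) :
    restr (T ∪ U) h = restr T h + restr U h := by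
  funext i
  have : i ∈ T → i ∉ U := fun hi => Finset.disjoint_left.mp hd hi
  by_cases h1 : i ∈ T <;> by_cases h2 : i ∈ U <;> simp_all [restr]

lemma exists_top {m : ℕ} (f : Fin m → ℝ) (U : Finset (Fin m)) (k : ℕ) (hk : k ≤ U.card) :
    ∃ T ⊆ U, T.card = k ∧ ∀ i ∈ T, ∀ j ∈ U \ T, f j ≤ f i := by
  induction k with
  | zero => exact ⟨∅, by simp, by simp, by simp⟩
  | succ k ih =>
    obtain ⟨T, hT, hc, hf⟩ := ih (by omega)
    have hne : (U \ T).Nonempty := by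
      rw [← Finset.card_pos, Finset.card_sdiff_of_subset hT]; omega
    obtain ⟨a, ha, hmax⟩ := Finset.exists_max_image (U \ T) f hne
    have ha' := Finset.mem_sdiff.mp ha
    refine ⟨insert a T, Finset.insert_subset ha'.1 hT, by
      rw [Finset.card_insert_of_notMem ha'.2, hc], ?_⟩
    intro i hi j hj
    have hj' : j ∈ U \ T := by
      simp only [Finset.mem_sdiff, Finset.mem_insert, not_or] at hj ⊢
      exact ⟨hj.1, hj.2.2⟩
    rcases Finset.mem_insert.mp hi with rfl | hi
    · exact hmax j hj'
    · exact hf i hi j hj'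

lemma exists_top' {m : ℕ} (f : Fin m → ℝ) (U : Finset (Fin m)) (k : ℕ) (hk0 : 0 < k)
    (hk : k ≤ U.card) :
    ∃ T ⊆ U, T.card = k ∧ ∃ i₀ ∈ T, (∀ i ∈ T, f i₀ ≤ f i) ∧ ∀ j ∈ U \ T, f j ≤ f i₀ := by
  obtain ⟨T, hT, hc, hf⟩ := exists_top f U k hk
  have hne : T.Nonempty := by rw [← Finset.card_pos]; omega
  obtain ⟨a, ha, hmin⟩ := Finset.exists_min_image T f hne
  exact ⟨T, hT, hc, a, ha, hmin, fun j hj => hf a ha j hj⟩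

/-- Block estimate. -/
lemma block {m : ℕ} (h : Fin m → ℝ) (T : Finset (Fin m)) (q M μ : ℝ) (hq : 0 < q)
    (hμ : 0 ≤ μ) (hμM : μ ≤ M) (hlo : ∀ i ∈ T, μ ≤ |h i|) (hhi : ∀ i ∈ T, |h i| ≤ M)
    (hc : (T.card : ℝ) = q ^ 2 ∨ μ = 0) :
    l2norm (restr T h) ≤ (∑ i ∈ T, |h i|) / q + q * (M - μ) / 4 := by
  set S := ∑ i ∈ T, |h i| with hS
  have hS0 : 0 ≤ S := Finset.sum_nonneg fun i _ => abs_nonneg _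
  have h1 : ∑ i ∈ T, (h i) ^ 2 ≤ (M + μ) * S - q ^ 2 * (M * μ) := by
    have : ∑ i ∈ T, (h i) ^ 2 ≤ ∑ i ∈ T, ((M + μ) * |h i| - M * μ) := by
      apply Finset.sum_le_sum
      intro i hi
      rw [← sq_abs]
      nlinarith [mul_nonneg (sub_nonneg.mpr (hlo i hi)) (sub_nonneg.mpr (hhi i hi))]
    rw [Finset.sum_sub_distrib, ← Finset.mul_sum, Finset.sum_const, nsmul_eq_mul] at this
    rcases hc with hc | hc
    · rwa [hc] at this
    · subst hc; simpa using this
  have hnn : 0 ≤ S / q + q * (M - μ) / 4 := by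
    have := sub_nonneg.mpr hμM
    positivity
  refine abs_le_of_sq_le_sq' ?_ hnn |>.2
  rw [l2norm_restr_sq]
  refine h1.trans ?_
  obtain ⟨u, hu⟩ : ∃ u, S = q ^ 2 * u := ⟨S / q ^ 2, by field_simp⟩
  have e : S / q + q * (M - μ) / 4 = q * (u + (M - μ) / 4) := by
    rw [hu]; field_simp
  rw [e, hu, mul_pow]
  have : (M + μ) * u - M * μ ≤ (u + (M - μ) / 4) ^ 2 := by
    nlinarith [sq_nonneg (u - (M + 3 * μ) / 4), mul_nonneg hμ (sub_nonneg.mpr hμM)]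
  nlinarith [mul_le_mul_of_nonneg_left this (sq_nonneg q)]

lemma tail {n m k : ℕ} (A : Matrix (Fin n) (Fin m) ℝ) (hk : 0 < k)
    (hA : RIP A k 0.2) (h : Fin m → ℝ) (q : ℝ) (hq : 0 < q) (hqk : q ^ 2 = k) :
    ∀ (N : ℕ) (U : Finset (Fin m)) (M : ℝ), U.card ≤ N → 0 ≤ M → (∀ i ∈ U, |h i| ≤ M) →
      l2norm (A.mulVec (restr U h)) ≤ 1.2 * ((∑ i ∈ U, |h i|) / q + q * M / 4) := by
  have small : ∀ (T : Finset (Fin m)) (M μ : ℝ), T.card ≤ k → 0 ≤ μ → μ ≤ M →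
      (∀ i ∈ T, μ ≤ |h i|) → (∀ i ∈ T, |h i| ≤ M) → (T.card = k ∨ μ = 0) →
      l2norm (A.mulVec (restr T h)) ≤ 1.2 * ((∑ i ∈ T, |h i|) / q + q * (M - μ) / 4) := by
    intro T M μ hT h0 hM hlo hhi hc
    have h1 := (hA _ (restr_sparse T h hT)).2
    have h2 := block h T q M μ hq h0 hM hlo hhi (hc.imp (fun e => by rw [e, hqk]) id)
    norm_num at h1 ⊢
    linarith
  intro N
  induction N with
  | zero =>
    intro U M hU hM hb
    have := small U M 0 (by omega) le_rfl hM (fun i _ => abs_nonneg _) hb (Or.inr rfl)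
    simpa using this
  | succ N ih =>
    intro U M hU hM hb
    by_cases hc : U.card ≤ k
    · have := small U M 0 hc le_rfl hM (fun i _ => abs_nonneg _) hb (Or.inr rfl)
      simpa using this
    · obtain ⟨T, hT, hTc, i₀, hi₀, hlo, hhi⟩ :=
        exists_top' (fun i => |h i|) U k hk (by omega)
      have a1 := small T M |h i₀| hTc.le (abs_nonneg _) (hb _ (hT hi₀)) hlo
        (fun i hi => hb i (hT hi)) (Or.inl hTc)
      have a2 := ih (U \ T) |h i₀| (by rw [Finset.card_sdiff_of_subset hT]; omega)
        (abs_nonneg _) hhi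
      have e : restr U h = restr T h + restr (U \ T) h := by
        rw [← restr_union _ _ Finset.disjoint_sdiff, Finset.union_sdiff_of_subset hT]
      have e2 := Finset.sum_sdiff (f := fun i => |h i|) hT
      rw [e, Matrix.mulVec_add]
      refine (l2norm_add_le _ _).trans ((add_le_add a1 a2).trans (le_of_eq ?_))
      rw [← e2]
      ring

theorem sparse_recovery_under_RIP (n m s : ℕ) (A : Matrix (Fin n) (Fin m) ℝ)
    (hA : RIP A (3 * s) 0.2) (x : Fin m → ℝ) (hx : IsSparse s x) :
    ∀ z : Fin m → ℝ, A.mulVec z = A.mulVec x → z ≠ x → l1norm x < l1norm z := by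
  intro z hz hne
  by_contra hlt
  push Not at hlt
  apply hne
  set h : Fin m → ℝ := z - x with hh
  have hAh : A.mulVec h = 0 := by rw [hh, Matrix.mulVec_sub, hz, sub_self]
  let S : Finset (Fin m) := Finset.univ.filter fun i => x i ≠ 0
  have hS : S.card ≤ s := by
    have : ({i | x i ≠ 0} : Set (Fin m)) = (S : Set (Fin m)) := by ext; simp [S]
    unfold IsSparse at hx
    rwa [this, Set.ncard_coe_finset] at hx
  -- cone condition
  have cone : ∑ i ∈ Sᶜ, |h i| ≤ ∑ i ∈ S, |h i| := by
    unfold l1norm at hlt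
    rw [← Finset.sum_add_sum_compl S, ← Finset.sum_add_sum_compl S] at hlt
    have c1 : ∑ i ∈ Sᶜ, |x i| = 0 := by
      apply Finset.sum_eq_zero
      intro i hi
      simpa [S] using hi
    have c2 : ∑ i ∈ Sᶜ, |h i| = ∑ i ∈ Sᶜ, |z i| := by
      apply Finset.sum_congr rfl
      intro i hi
      have : x i = 0 := by simpa [S] using hi
      simp [hh, this]
    have c3 : ∑ i ∈ S, |x i| ≤ ∑ i ∈ S, |z i| + ∑ i ∈ S, |h i| := by
      rw [← Finset.sum_add_distrib]
      apply Finset.sum_le_sum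
      intro i _
      have : x i = z i - h i := by simp [hh]
      rw [this]
      exact abs_sub _ _
    linarith
  -- it suffices that h vanishes on S
  have fin : (∑ i ∈ S, |h i|) ≤ 0 → z = x := by
    intro h0
    have : ∑ i, |h i| ≤ 0 := by
      rw [← Finset.sum_add_sum_compl S]; linarith
    have h1 := (Finset.sum_eq_zero_iff_of_nonneg (fun i _ => abs_nonneg (h i))).mp
      (le_antisymm this (Finset.sum_nonneg fun i _ => abs_nonneg _))
    funext i
    have := h1 i (Finset.mem_univ i)
    have := abs_eq_zero.mp this
    simp only [hh, Pi.sub_apply] at this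
    linarith
  apply fin
  rcases Nat.eq_zero_or_pos s with hs | hs
  · have : S = ∅ := Finset.card_eq_zero.mp (by omega)
    simp [this]
  have CS : ∀ W : Finset (Fin m), S ⊆ W →
      (∑ i ∈ S, |h i|) ^ 2 ≤ s * l2norm (restr W h) ^ 2 := by
    intro W hW
    have h1 := sq_sum_le_card_mul_sum_sq (s := S) (f := fun i => |h i|)
    simp only [sq_abs] at h1
    have h2 : ∑ i ∈ S, h i ^ 2 ≤ ∑ i ∈ W, h i ^ 2 :=
      Finset.sum_le_sum_of_subset_of_nonneg hW fun i _ _ => sq_nonneg _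
    rw [l2norm_restr_sq]
    refine h1.trans (mul_le_mul (by exact_mod_cast hS) h2
      (Finset.sum_nonneg fun i _ => sq_nonneg _) (by positivity))
  have done : ∀ W : Finset (Fin m), S ⊆ W → l2norm (restr W h) = 0 →
      (∑ i ∈ S, |h i|) ≤ 0 := by
    intro W hW h0
    have := CS W hW
    rw [h0] at this
    have h3 : (∑ i ∈ S, |h i|) ^ 2 ≤ 0 := by simpa using this
    exact (pow_eq_zero_iff two_ne_zero).mp (le_antisymm h3 (sq_nonneg _)) |>.le
  have hzero : l2norm (0 : Fin n → ℝ) = 0 := by simp [l2norm]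
  by_cases hc : Sᶜ.card < 2 * s
  · have hu : restr Finset.univ h = h := by funext i; simp [restr]
    have hcard : (Finset.univ : Finset (Fin m)).card ≤ 3 * s := by
      have := Finset.card_add_card_compl S
      rw [Finset.card_univ]; omega
    have := (hA _ (restr_sparse Finset.univ h hcard)).1
    rw [hu, hAh, hzero] at this
    apply done Finset.univ (Finset.subset_univ _)
    rw [hu]
    have h0 := l2norm_nonneg' h
    norm_num at this
    linarith
  obtain ⟨T, hT, hTc, i₀, hi₀, hlo, hhi⟩ :=
    exists_top' (fun i => |h i|) Sᶜ (2 * s) (by omega) (by omega)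
  have hdST : Disjoint S T := by
    rw [Finset.disjoint_left]
    intro i hi hi'
    exact Finset.mem_compl.mp (hT hi') hi
  have hspos : (0 : ℝ) < s := by exact_mod_cast hs
  set q : ℝ := Real.sqrt (3 * s) with hqdef
  have hq : 0 < q := Real.sqrt_pos.mpr (by positivity)
  have hq2 : q ^ 2 = 3 * s := Real.sq_sqrt (by positivity)
  have tl := tail A (k := 3 * s) (by omega) hA h q hq (by push_cast; exact hq2) _ (Sᶜ \ T)
    |h i₀| le_rfl (abs_nonneg _) hhi
  have hsplit : h = restr (S ∪ T) h + restr (Sᶜ \ T) h := by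
    rw [← restr_union]
    · funext i
      by_cases h1 : i ∈ S <;> by_cases h2 : i ∈ T <;> simp [restr, h1, h2]
    · rw [Finset.disjoint_left]
      intro i hi
      simp only [Finset.mem_union, Finset.mem_sdiff, Finset.mem_compl] at hi ⊢
      tauto
  have hAeq : A.mulVec (restr (S ∪ T) h) = -A.mulVec (restr (Sᶜ \ T) h) := by
    rw [hsplit, Matrix.mulVec_add] at hAh
    exact eq_neg_of_add_eq_zero_left hAh
  have lower := (hA _ (restr_sparse (S ∪ T) h (k := 3 * s)
    (by have := Finset.card_union_le S T; omega))).1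
  rw [hAeq, l2norm_neg'] at lower
  have hW := CS (S ∪ T) Finset.subset_union_left
  apply done (S ∪ T) Finset.subset_union_left
  have hN := l2norm_nonneg' (restr (S ∪ T) h)
  set N := l2norm (restr (S ∪ T) h)
  set P := ∑ i ∈ S, |h i|
  have hP : 0 ≤ P := Finset.sum_nonneg fun i _ => abs_nonneg _
  have e2 := Finset.sum_sdiff (f := fun i => |h i|) hT
  have ht : 2 * s * |h i₀| ≤ ∑ i ∈ T, |h i| := by
    have := Finset.card_nsmul_le_sum T (fun i => |h i|) |h i₀| hlo
    rw [hTc, nsmul_eq_mul] at this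
    push_cast at this
    exact this
  have hM := abs_nonneg (h i₀)
  have key : (∑ i ∈ Sᶜ \ T, |h i|) / q + q * |h i₀| / 4 ≤ P / q := by
    rw [le_div_iff₀ hq]
    have : ((∑ i ∈ Sᶜ \ T, |h i|) / q + q * |h i₀| / 4) * q
        = (∑ i ∈ Sᶜ \ T, |h i|) + q ^ 2 * |h i₀| / 4 := by field_simp
    rw [this, hq2]
    nlinarith [mul_nonneg hspos.le hM]
  have f1 : 0.8 * N ≤ 1.2 * (P / q) := by
    norm_num at lower tl ⊢
    linarith
  have f2 : 0.8 * N * q ≤ 1.2 * P := by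
    have := mul_le_mul_of_nonneg_right f1 hq.le
    have e : 1.2 * (P / q) * q = 1.2 * P := by field_simp
    linarith
  have f3 : (0.8 * N * q) ^ 2 ≤ (1.2 * P) ^ 2 := pow_le_pow_left₀ (by positivity) f2 2
  have f4 : (s : ℝ) * N ^ 2 ≤ 0 := by
    rw [mul_pow, hq2] at f3
    norm_num [mul_pow] at f3 ⊢
    nlinarith
  have f5 : N ^ 2 ≤ 0 := by
    by_contra hcon
    push Not at hcon
    nlinarith [mul_pos hspos hcon]
  exact (pow_eq_zero_iff two_ne_zero).mp (le_antisymm f5 (sq_nonneg _))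
end

section
/- There exist universal constants C, γ > 0 with the following property. Let ν be a probability measure on a measurable set D ⊆ ℝ^d, let ψ_1, …, ψ_m : D → ℝ be a bounded orthonormal system with constant K ≥ 1, let δ ∈ (0,1) and s ≥ 2, and suppose n ≥ (C/δ²)·K²·s·(ln s)³·ln m. Draw x_1, …, x_n independently from ν (i.e., consider the product measure ν^{⊗n} on D^n) and form the matrix Ψ ∈ ℝ^{n×m} with entries Ψ_{j,k} = ψ_k(x_j). Then with probability at least 1 − m^{−γ (ln s)³}, the matrix (1/√n)·Ψ satisfies RIP(s, δ). -/
open MeasureTheory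

noncomputable def sg (b : Bool) : ℝ := if b then 1 else -1

lemma sg_sum_exp (t : ℝ) : ∑ b : Bool, Real.exp (t * sg b) = 2 * Real.cosh t := by
  simp [sg, Real.cosh_eq]; ring

lemma hoeff_mgf (n : ℕ) (c : Fin n → ℝ) (V t : ℝ) (hV : ∑ j, c j ^ 2 ≤ V) :
    ∑ ε : Fin n → Bool, Real.exp (t * ∑ j, sg (ε j) * c j) ≤ 2 ^ n * Real.exp (t ^ 2 * V / 2) := by
  have h1 : ∑ ε : Fin n → Bool, Real.exp (t * ∑ j, sg (ε j) * c j)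
      = ∏ j : Fin n, ∑ b : Bool, Real.exp ((t * c j) * sg b) := by
    rw [Finset.prod_univ_sum]
    rw [Fintype.piFinset_univ]
    refine Finset.sum_congr rfl fun ε _ => ?_
    rw [← Real.exp_sum, Finset.mul_sum]
    congr 1
    refine Finset.sum_congr rfl fun j _ => ?_
    ring
  rw [h1]
  calc ∏ j : Fin n, ∑ b : Bool, Real.exp ((t * c j) * sg b)
      ≤ ∏ j : Fin n, (2 * Real.exp ((t * c j) ^ 2 / 2)) := by
        refine Finset.prod_le_prod (fun j _ => Finset.sum_nonneg fun b _ => (Real.exp_pos _).le) ?_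
        intro j _
        rw [sg_sum_exp]
        have := Real.cosh_le_exp_half_sq (t * c j)
        linarith
    _ = 2 ^ n * Real.exp (t ^ 2 * (∑ j, c j ^ 2) / 2) := by
        rw [Finset.prod_mul_distrib, ← Real.exp_sum]
        simp only [Finset.prod_const, Finset.card_univ, Fintype.card_fin]
        congr 2
        rw [Finset.mul_sum, Finset.sum_div]
        refine Finset.sum_congr rfl fun j _ => ?_
        ring
    _ ≤ _ := by
        gcongr

lemma hoeff (n : ℕ) (c : Fin n → ℝ) (V u : ℝ) (hVp : 0 < V) (hu : 0 ≤ u) (hV : ∑ j, c j ^ 2 ≤ V) :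
    (((Finset.univ : Finset (Fin n → Bool)).filter
      (fun ε => u < |∑ j, sg (ε j) * c j|)).card : ℝ) ≤ 2 ^ n * (2 * Real.exp (-(u ^ 2 / (2 * V)))) := by
  set t := u / V with ht
  have ht0 : 0 ≤ t := by positivity
  have key : (((Finset.univ : Finset (Fin n → Bool)).filter
      (fun ε => u < |∑ j, sg (ε j) * c j|)).card : ℝ) * Real.exp (t * u) ≤
      2 ^ n * Real.exp (t ^ 2 * V / 2) + 2 ^ n * Real.exp ((-t) ^ 2 * V / 2) := by
    refine le_trans ?_ (add_le_add (hoeff_mgf n c V t hV) (hoeff_mgf n c V (-t) hV))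
    rw [← Finset.sum_add_distrib, ← nsmul_eq_mul, ← Finset.sum_const]
    refine le_trans (Finset.sum_le_sum (g := fun ε : Fin n → Bool =>
      Real.exp (t * ∑ j, sg (ε j) * c j) + Real.exp (-t * ∑ j, sg (ε j) * c j)) ?_)
      (Finset.sum_le_sum_of_subset_of_nonneg (Finset.filter_subset _ _) ?_)
    · intro ε hε
      have hε := (Finset.mem_filter.1 hε).2
      rcases lt_abs.1 hε with h | h
      · have : Real.exp (t * u) ≤ Real.exp (t * ∑ j, sg (ε j) * c j) := by gcongr
        have := Real.exp_pos (-t * ∑ j, sg (ε j) * c j)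
        linarith
      · have : Real.exp (t * u) ≤ Real.exp (-t * ∑ j, sg (ε j) * c j) := by
          rw [neg_mul, ← mul_neg]; gcongr
        have := Real.exp_pos (t * ∑ j, sg (ε j) * c j)
        linarith
    · intro ε _ _
      positivity
  have e1 : t * u = u ^ 2 / V := by rw [ht]; ring
  have e2 : t ^ 2 * V / 2 = u ^ 2 / (2 * V) := by rw [ht]; field_simp
  rw [neg_sq, e2, e1] at key
  have e3 : Real.exp (u ^ 2 / (2 * V)) = Real.exp (-(u ^ 2 / (2 * V))) * Real.exp (u ^ 2 / V) := by
    rw [← Real.exp_add]; congr 1; field_simp; ring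
  rw [e3] at key
  have := Real.exp_pos (u ^ 2 / V)
  refine le_of_mul_le_mul_right ?_ this
  linarith

lemma taylor_pow (S Y : ℝ) (r : ℕ) :
    |(S + Y) ^ (r + 2) - S ^ (r + 2) - (r + 2) * S ^ (r + 1) * Y| ≤
      (r + 2) * (r + 1) / 2 * Y ^ 2 * (|S| + |Y|) ^ r := by
  induction r with
  | zero =>
    have : (S + Y) ^ (0 + 2) - S ^ (0 + 2) - ((0 : ℕ) + 2 : ℝ) * S ^ (0 + 1) * Y = Y ^ 2 := by
      push_cast; ring
    rw [this, abs_of_nonneg (sq_nonneg _)]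
    apply le_of_eq; push_cast; ring
  | succ r ih =>
    have e : (S + Y) ^ (r + 1 + 2) - S ^ (r + 1 + 2) - ((r + 1 : ℕ) + 2 : ℝ) * S ^ (r + 1 + 1) * Y
        = (S + Y) * ((S + Y) ^ (r + 2) - S ^ (r + 2) - (r + 2) * S ^ (r + 1) * Y)
          + (r + 2) * S ^ (r + 1) * Y ^ 2 := by
      push_cast; ring
    rw [e]
    refine (abs_add_le _ _).trans ?_
    rw [abs_mul]
    have h1 : |S + Y| * |(S + Y) ^ (r + 2) - S ^ (r + 2) - (r + 2) * S ^ (r + 1) * Y| ≤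
        (|S| + |Y|) * ((r + 2) * (r + 1) / 2 * Y ^ 2 * (|S| + |Y|) ^ r) := by
      gcongr; exact abs_add_le _ _
    have h2 : |(r + 2 : ℝ) * S ^ (r + 1) * Y ^ 2| ≤ (r + 2) * (|S| + |Y|) ^ (r + 1) * Y ^ 2 := by
      rw [abs_mul, abs_mul, abs_of_nonneg (sq_nonneg Y), abs_pow,
        abs_of_nonneg (by positivity : (0 : ℝ) ≤ r + 2)]
      gcongr
      have := abs_nonneg Y
      linarith
    refine (add_le_add h1 h2).trans (le_of_eq ?_)
    push_cast; ring

lemma pow_bd (S Y : ℝ) (q : ℕ) :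
    (|S| + |Y|) ^ (2 * q) ≤ 3 * (S ^ 2 + (q + 1) * Y ^ 2) ^ q := by
  have h1 : (|S| + |Y|) ^ 2 ≤ (1 + 1 / (q + 1 : ℝ)) * (S ^ 2 + (q + 1) * Y ^ 2) := by
    have hq : (0 : ℝ) < q + 1 := by positivity
    have e : (1 + 1 / (q + 1 : ℝ)) * (S ^ 2 + (q + 1) * Y ^ 2) - (|S| + |Y|) ^ 2
        = (|S| - (q + 1) * |Y|) ^ 2 / (q + 1) := by
      rw [← sq_abs S, ← sq_abs Y]; field_simp; ring
    have : 0 ≤ (|S| - (q + 1) * |Y|) ^ 2 / (q + 1 : ℝ) := by positivity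
    linarith
  rw [pow_mul]
  calc ((|S| + |Y|) ^ 2) ^ q ≤ ((1 + 1 / (q + 1 : ℝ)) * (S ^ 2 + (q + 1) * Y ^ 2)) ^ q := by gcongr
    _ = (1 + 1 / (q + 1 : ℝ)) ^ q * (S ^ 2 + (q + 1) * Y ^ 2) ^ q := by rw [mul_pow]
    _ ≤ 3 * (S ^ 2 + (q + 1) * Y ^ 2) ^ q := by
      gcongr
      calc (1 + 1 / (q + 1 : ℝ)) ^ q ≤ (Real.exp (1 / (q + 1 : ℝ))) ^ q := by
            gcongr; have := Real.add_one_le_exp (1 / (q + 1 : ℝ)); linarith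
        _ = Real.exp (q * (1 / (q + 1 : ℝ))) := by rw [← Real.exp_nat_mul]
        _ ≤ Real.exp 1 := by
            gcongr; rw [mul_one_div, div_le_one (by positivity)]; linarith
        _ ≤ 3 := by have := Real.exp_one_lt_d9; linarith

lemma young_pow (y z : ℝ) (hy : 0 ≤ y) (hz : 0 ≤ z) (q : ℕ) :
    (q + 1) * (y * z ^ q) ≤ y ^ (q + 1) + q * z ^ (q + 1) := by
  induction q with
  | zero => simp
  | succ q ih =>
    have h := mul_le_mul_of_nonneg_right ih hz
    have h2 : 0 ≤ (y - z) * (y ^ (q + 1) - z ^ (q + 1)) := by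
      rcases le_total y z with h | h
      · exact mul_nonneg_of_nonpos_of_nonpos (by linarith)
          (by have := pow_le_pow_left₀ hy h (q + 1); linarith)
      · exact mul_nonneg (by linarith)
          (by have := pow_le_pow_left₀ hz h (q + 1); linarith)
    push_cast
    ring_nf at h h2 ⊢
    linarith

lemma holder_bd {J : Type*} [Fintype J] (ω : ℝ) (hω : 0 ≤ ω) (S Y : J → ℝ) (q : ℕ) (A B : ℝ)
    (hA : 0 < A) (hB : 0 < B) (hS : ∑ j, ω * (S j) ^ (2 * (q + 1)) ≤ A ^ (q + 1))
    (hY : ∑ j, ω * (Y j) ^ (2 * (q + 1)) ≤ B ^ (q + 1)) :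
    ∑ j, ω * (Y j ^ 2 * (S j ^ 2 + (q + 1) * Y j ^ 2) ^ q) ≤ B * (A + (q + 1) * B) ^ q := by
  set D := A + (q + 1) * B with hD
  have hDp : 0 < D := by positivity
  have hpt : ∀ j, ω * (Y j ^ 2 * (S j ^ 2 + (q + 1) * Y j ^ 2) ^ q) ≤
      B * D ^ q * ((1 / (q + 1)) * (ω * (Y j) ^ (2 * (q + 1)) / B ^ (q + 1))
       + (q / (q + 1)) * ((A / D) * (ω * (S j) ^ (2 * (q + 1)) / A ^ (q + 1))
         + ((q + 1) * B / D) * (ω * (Y j) ^ (2 * (q + 1)) / B ^ (q + 1)))) := by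
    intro j
    set y := Y j ^ 2 / B with hy
    set σ := S j ^ 2 / A with hσ
    have hy0 : 0 ≤ y := by positivity
    have hσ0 : 0 ≤ σ := by positivity
    set z := (A / D) * σ + ((q + 1) * B / D) * y with hz
    have hz0 : 0 ≤ z := by positivity
    have e1 : S j ^ 2 + (q + 1) * Y j ^ 2 = D * z := by
      rw [hz, hσ, hy]; field_simp
    have e2 : Y j ^ 2 = B * y := by rw [hy]; field_simp
    have e3 : (Y j) ^ (2 * (q + 1)) / B ^ (q + 1) = y ^ (q + 1) := by
      rw [hy, div_pow, pow_mul]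
    have e4 : (S j) ^ (2 * (q + 1)) / A ^ (q + 1) = σ ^ (q + 1) := by
      rw [hσ, div_pow, pow_mul]
    have h1 := young_pow y z hy0 hz0 q
    have h2 : z ^ (q + 1) ≤ (A / D) * σ ^ (q + 1) + ((q + 1) * B / D) * y ^ (q + 1) := by
      have h0 : (A / D) + ((q + 1) * B / D) = 1 := by rw [hD]; field_simp
      have := (convexOn_pow (𝕜 := ℝ) (q + 1)).2 (Set.mem_Ici.2 hσ0) (Set.mem_Ici.2 hy0)
        (by positivity : (0 : ℝ) ≤ A / D) (by positivity : (0 : ℝ) ≤ (q + 1) * B / D) h0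
      simpa using this
    have h3 : y * z ^ q ≤ (1 / (q + 1)) * y ^ (q + 1) + (q / (q + 1)) *
        ((A / D) * σ ^ (q + 1) + ((q + 1) * B / D) * y ^ (q + 1)) := by
      have h4 : y * z ^ q ≤ (1 / (q + 1)) * y ^ (q + 1) + (q / (q + 1)) * z ^ (q + 1) := by
        have hq : (0 : ℝ) < q + 1 := by positivity
        have e5 : (1 / (q + 1 : ℝ)) * y ^ (q + 1) + (q / (q + 1)) * z ^ (q + 1)
          = (y ^ (q + 1) + q * z ^ (q + 1)) / (q + 1) := by field_simp
        rw [e5, le_div_iff₀ hq]; linarith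
      refine h4.trans ?_
      gcongr
    simp only [mul_div_assoc ω, e3, e4]
    rw [e1, mul_pow, e2]
    calc ω * (B * y * (D ^ q * z ^ q)) = B * D ^ q * ω * (y * z ^ q) := by ring
      _ ≤ B * D ^ q * ω * ((1 / (q + 1)) * y ^ (q + 1) + (q / (q + 1)) *
        ((A / D) * σ ^ (q + 1) + ((q + 1) * B / D) * y ^ (q + 1))) := by gcongr
      _ = _ := by ring
  refine (Finset.sum_le_sum fun j _ => hpt j).trans ?_
  rw [← Finset.mul_sum, Finset.sum_add_distrib, ← Finset.mul_sum, ← Finset.mul_sum,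
    Finset.sum_add_distrib, ← Finset.mul_sum, ← Finset.mul_sum, ← Finset.sum_div, ← Finset.sum_div]
  have h1 : (∑ j, ω * (S j) ^ (2 * (q + 1))) / A ^ (q + 1) ≤ 1 := by
    rw [div_le_one (by positivity)]; exact hS
  have h2 : (∑ j, ω * (Y j) ^ (2 * (q + 1))) / B ^ (q + 1) ≤ 1 := by
    rw [div_le_one (by positivity)]; exact hY
  calc _ ≤ B * D ^ q * ((1 / (q + 1)) * 1 + (q / (q + 1)) * ((A / D) * 1 + ((q + 1) * B / D) * 1)) := by
        gcongr
    _ = _ := by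
        have : A / D * 1 + ((q + 1) * B / D) * 1 = 1 := by rw [hD]; field_simp
        rw [this]; field_simp; ring


lemma greedy_step {J I : Type*} [Fintype J] [Fintype I] (ω : ℝ) (hω : 0 ≤ ω) (S : J → ℝ)
    (Y : I → J → ℝ) (θ : I → ℝ) (hθ : ∀ i, 0 ≤ θ i) (hθ1 : ∑ i, θ i = 1)
    (hmean : ∀ j, ∑ i, θ i * Y i j = 0) (q : ℕ) (A B : ℝ) (hA : 0 < A) (hB : 0 < B)
    (hS : ∑ j, ω * (S j) ^ (2 * (q + 1)) ≤ A ^ (q + 1))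
    (hY : ∀ i, ∑ j, ω * (Y i j) ^ (2 * (q + 1)) ≤ B ^ (q + 1)) :
    ∃ i, ∑ j, ω * (S j + Y i j) ^ (2 * (q + 1)) ≤ (A + 7 * (q + 1) * B) ^ (q + 1) := by
  have hI : Nonempty I := by
    by_contra h
    rw [not_nonempty_iff] at h
    simp at hθ1
  have hpt : ∀ i, ∑ j, ω * (S j + Y i j) ^ (2 * (q + 1)) ≤
      A ^ (q + 1) + ∑ j, ω * ((2 * q + 2) * S j ^ (2 * q + 1)) * Y i j
        + 6 * (q + 1) ^ 2 * (B * (A + (q + 1) * B) ^ q) := by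
    intro i
    have h1 : ∀ j, ω * (S j + Y i j) ^ (2 * (q + 1)) ≤ ω * (S j) ^ (2 * (q + 1))
        + ω * ((2 * q + 2) * S j ^ (2 * q + 1)) * Y i j
        + 6 * (q + 1) ^ 2 * (ω * (Y i j ^ 2 * (S j ^ 2 + (q + 1) * Y i j ^ 2) ^ q)) := by
      intro j
      have t := taylor_pow (S j) (Y i j) (2 * q)
      have t2 := (abs_le.1 t).2
      have b := pow_bd (S j) (Y i j) q
      have hq : (0 : ℝ) ≤ q := Nat.cast_nonneg q
      have t3 : ((2 * q : ℕ) + 2 : ℝ) * ((2 * q : ℕ) + 1) / 2 * Y i j ^ 2 * (|S j| + |Y i j|) ^ (2 * q)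
          ≤ 6 * (q + 1) ^ 2 * (Y i j ^ 2 * (S j ^ 2 + (q + 1) * Y i j ^ 2) ^ q) := by
        push_cast
        calc (2 * q + 2 : ℝ) * (2 * q + 1) / 2 * Y i j ^ 2 * (|S j| + |Y i j|) ^ (2 * q)
            ≤ (2 * q + 2 : ℝ) * (2 * q + 2) / 2 * Y i j ^ 2 *
              (3 * (S j ^ 2 + (q + 1) * Y i j ^ 2) ^ q) := by
              gcongr; linarith
          _ = _ := by ring
      have e : 2 * (q + 1) = 2 * q + 2 := by ring
      rw [e]
      have t4 : (S j + Y i j) ^ (2 * q + 2) ≤ S j ^ (2 * q + 2) + (2 * q + 2) * S j ^ (2 * q + 1) * Y i j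
          + 6 * (q + 1) ^ 2 * (Y i j ^ 2 * (S j ^ 2 + (q + 1) * Y i j ^ 2) ^ q) := by
        push_cast at t2 t3 ⊢
        linarith
      calc _ ≤ ω * (S j ^ (2 * q + 2) + (2 * q + 2) * S j ^ (2 * q + 1) * Y i j
          + 6 * (q + 1) ^ 2 * (Y i j ^ 2 * (S j ^ 2 + (q + 1) * Y i j ^ 2) ^ q)) := by gcongr
        _ = _ := by ring
    refine (Finset.sum_le_sum fun j _ => h1 j).trans ?_
    rw [Finset.sum_add_distrib, Finset.sum_add_distrib]
    have := holder_bd ω hω S (Y i) q A B hA hB hS (hY i)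
    refine add_le_add (add_le_add hS le_rfl) ?_
    rw [← Finset.mul_sum]
    gcongr
  obtain ⟨i, -, hi⟩ := Finset.exists_min_image Finset.univ
    (fun i => ∑ j, ω * (S j + Y i j) ^ (2 * (q + 1))) Finset.univ_nonempty
  refine ⟨i, ?_⟩
  set b := A + (q + 1) * B with hb
  have hfin : A ^ (q + 1) + 6 * (q + 1) ^ 2 * (B * b ^ q) ≤ (A + 7 * (q + 1) * B) ^ (q + 1) := by
    have hbp : 0 < b := by positivity
    have h1 : A ^ (q + 1) ≤ b ^ (q + 1) := by
      gcongr; rw [hb]; have : 0 ≤ (q + 1) * B := by positivity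
      linarith
    have h2 := one_add_mul_le_pow (a := 6 * (q + 1) * B / b) (by
      have : 0 ≤ 6 * (q + 1) * B / b := by positivity
      linarith) (q + 1)
    have e : A + 7 * (q + 1) * B = b * (1 + 6 * (q + 1) * B / b) := by
      rw [mul_add b, mul_div_cancel₀ _ hbp.ne', hb]; ring
    rw [e, mul_pow]
    calc _ ≤ b ^ (q + 1) + 6 * (q + 1) ^ 2 * (B * b ^ q) := by linarith
      _ = b ^ (q + 1) * (1 + ((q + 1 : ℕ) : ℝ) * (6 * (q + 1) * B / b)) := by
        push_cast; field_simp; ring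
      _ ≤ _ := by gcongr
  refine le_trans ?_ hfin
  calc ∑ j, ω * (S j + Y i j) ^ (2 * (q + 1))
      = ∑ i', θ i' * (∑ j, ω * (S j + Y i j) ^ (2 * (q + 1))) := by
        rw [← Finset.sum_mul, hθ1, one_mul]
    _ ≤ ∑ i', θ i' * (∑ j, ω * (S j + Y i' j) ^ (2 * (q + 1))) := by
        refine Finset.sum_le_sum fun i' _ => mul_le_mul_of_nonneg_left (hi i' (Finset.mem_univ _)) (hθ i')
    _ ≤ ∑ i', θ i' * (A ^ (q + 1) + ∑ j, ω * ((2 * q + 2) * S j ^ (2 * q + 1)) * Y i' j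
        + 6 * (q + 1) ^ 2 * (B * b ^ q)) := by
        refine Finset.sum_le_sum fun i' _ => mul_le_mul_of_nonneg_left (hpt i') (hθ i')
    _ = A ^ (q + 1) + 6 * (q + 1) ^ 2 * (B * b ^ q) := by
        have h0 : ∑ i', θ i' * ∑ j, ω * ((2 * q + 2) * S j ^ (2 * q + 1)) * Y i' j = 0 := by
          simp_rw [Finset.mul_sum]
          rw [Finset.sum_comm]
          refine Finset.sum_eq_zero fun j _ => ?_
          have := hmean j
          calc _ = ω * ((2 * q + 2) * S j ^ (2 * q + 1)) * ∑ i, θ i * Y i j := by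
                rw [Finset.mul_sum]; refine Finset.sum_congr rfl fun i _ => ?_; ring
            _ = 0 := by rw [this, mul_zero]
        simp_rw [mul_add]
        rw [Finset.sum_add_distrib, Finset.sum_add_distrib, h0, ← Finset.sum_mul, ← Finset.sum_mul, hθ1]
        ring

lemma greedy {J I : Type*} [Fintype J] [Fintype I] (ω : ℝ) (hω : 0 ≤ ω)
    (Y : I → J → ℝ) (θ : I → ℝ) (hθ : ∀ i, 0 ≤ θ i) (hθ1 : ∑ i, θ i = 1)
    (hmean : ∀ j, ∑ i, θ i * Y i j = 0) (q : ℕ) (B : ℝ) (hB : 0 < B)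
    (hY : ∀ i, ∑ j, ω * (Y i j) ^ (2 * (q + 1)) ≤ B ^ (q + 1)) (k : ℕ) :
    ∃ c : Fin k → I, ∑ j, ω * (∑ r, Y (c r) j) ^ (2 * (q + 1)) ≤ (7 * (q + 1) * (k + 1) * B) ^ (q + 1) := by
  induction k with
  | zero =>
    refine ⟨Fin.elim0, ?_⟩
    simp
    positivity
  | succ k ih =>
    obtain ⟨c, hc⟩ := ih
    obtain ⟨i, hi⟩ := greedy_step ω hω (fun j => ∑ r, Y (c r) j) Y θ hθ hθ1 hmean q
      (7 * (q + 1) * (k + 1) * B) B (by positivity) hB hc hY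
    refine ⟨Fin.snoc c i, ?_⟩
    simp only [Fin.sum_univ_castSucc, Fin.snoc_castSucc, Fin.snoc_last]
    refine hi.trans (le_of_eq ?_)
    push_cast; ring

lemma maurey {J : Type*} [Fintype J] {m : ℕ} (hm : 0 < m) (ω : ℝ) (hω : 0 ≤ ω) (φ : Fin m → J → ℝ)
    (hφ1 : ∀ l j, |φ l j| ≤ 1) (hφ2 : ∀ l, ∑ j, ω * φ l j ^ 2 ≤ 1) (v : Fin m → ℝ)
    (hv : ∑ l, |v l| ≤ 1) (q k : ℕ) (hk : 0 < k) :
    ∃ c : Fin k → Fin m × Bool,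
      ∑ j, ω * ((1 / k) * (∑ r, sg (c r).2 * φ (c r).1 j) - ∑ l, v l * φ l j) ^ (2 * (q + 1))
        ≤ (56 * (q + 1) / k) ^ (q + 1) := by
  set τ := 1 - ∑ l, |v l| with hτ
  have hτ0 : 0 ≤ τ := by linarith
  set θ : Fin m × Bool → ℝ := fun i => (|v i.1| + τ / m + sg i.2 * v i.1) / 2 with hθd
  have hm' : (m : ℝ) ≠ 0 := by positivity
  have hθ : ∀ i, 0 ≤ θ i := by
    rintro ⟨l, b⟩
    have h1 : 0 ≤ τ / m := by positivity
    have h2 := neg_abs_le (v l)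
    have h3 := le_abs_self (v l)
    cases b <;> simp only [hθd, sg] <;> norm_num <;> linarith
  have hθ1 : ∑ i, θ i = 1 := by
    rw [Fintype.sum_prod_type]
    simp only [hθd, sg, Fintype.sum_bool]
    have : ∀ l : Fin m, (|v l| + τ / m + (if True then (1:ℝ) else -1) * v l) / 2
      + (|v l| + τ / m + (if False then (1:ℝ) else -1) * v l) / 2 = |v l| + τ / m := by
      intro l; simp; ring
    simp only [Bool.false_eq_true] at this ⊢
    rw [Finset.sum_congr rfl fun l _ => this l, Finset.sum_add_distrib]
    simp
    field_simp
    rw [hτ]; ring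
  have hmean0 : ∀ j, ∑ i : Fin m × Bool, θ i * (sg i.2 * φ i.1 j) = ∑ l, v l * φ l j := by
    intro j
    rw [Fintype.sum_prod_type]
    refine Finset.sum_congr rfl fun l _ => ?_
    simp [hθd, sg]; ring
  set Y : Fin m × Bool → J → ℝ := fun i j => sg i.2 * φ i.1 j - ∑ l, v l * φ l j with hYd
  have hmean : ∀ j, ∑ i, θ i * Y i j = 0 := by
    intro j
    simp only [hYd, mul_sub]
    rw [Finset.sum_sub_distrib, hmean0 j, ← Finset.sum_mul, hθ1]; ring
  have hev : Even (2 * (q + 1)) := even_two_mul _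
  have hsg : ∀ (b : Bool) (x : ℝ), (sg b * x) ^ (2 * (q + 1)) = x ^ (2 * (q + 1)) := by
    intro b x
    rw [pow_mul, pow_mul]
    cases b <;> simp [sg]
  have hφp : ∀ l, ∑ j, ω * φ l j ^ (2 * (q + 1)) ≤ 1 := by
    intro l
    refine le_trans (Finset.sum_le_sum fun j _ => ?_) (hφ2 l)
    refine mul_le_mul_of_nonneg_left ?_ hω
    rw [pow_mul, ← sq_abs]
    have h1 := hφ1 l j
    have h0 := abs_nonneg (φ l j)
    have h2 : |φ l j| ^ 2 ≤ 1 := pow_le_one₀ h0 h1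
    calc (|φ l j| ^ 2) ^ (q + 1) ≤ (|φ l j| ^ 2) ^ 1 := pow_le_pow_of_le_one (by positivity) h2 (by omega)
      _ = _ := pow_one _
  have hfp : ∑ j, ω * (∑ l, v l * φ l j) ^ (2 * (q + 1)) ≤ 1 := by
    calc ∑ j, ω * (∑ l, v l * φ l j) ^ (2 * (q + 1))
        ≤ ∑ j, ω * ∑ i : Fin m × Bool, θ i * φ i.1 j ^ (2 * (q + 1)) := by
          refine Finset.sum_le_sum fun j _ => mul_le_mul_of_nonneg_left ?_ hω
          rw [← hmean0 j]
          refine (Real.pow_arith_mean_le_arith_mean_pow_of_even Finset.univ θ _ (fun i _ => hθ i) hθ1 hev).trans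
            (le_of_eq ?_)
          refine Finset.sum_congr rfl fun i _ => ?_
          rw [hsg]
      _ = ∑ i : Fin m × Bool, θ i * ∑ j, ω * φ i.1 j ^ (2 * (q + 1)) := by
          simp_rw [Finset.mul_sum]
          rw [Finset.sum_comm]
          refine Finset.sum_congr rfl fun i _ => Finset.sum_congr rfl fun j _ => ?_
          ring
      _ ≤ ∑ i : Fin m × Bool, θ i * 1 := by
          refine Finset.sum_le_sum fun i _ => mul_le_mul_of_nonneg_left (hφp _) (hθ i)
      _ = 1 := by simp [hθ1]
  have hY : ∀ i, ∑ j, ω * (Y i j) ^ (2 * (q + 1)) ≤ 4 ^ (q + 1) := by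
    intro i
    calc ∑ j, ω * (Y i j) ^ (2 * (q + 1))
        ≤ ∑ j, 2 ^ (2 * (q + 1) - 1) * (ω * φ i.1 j ^ (2 * (q + 1))
            + ω * (∑ l, v l * φ l j) ^ (2 * (q + 1))) := by
          refine Finset.sum_le_sum fun j _ => ?_
          have := hev.add_pow_le (a := sg i.2 * φ i.1 j) (b := -∑ l, v l * φ l j)
          rw [hev.neg_pow, hsg, ← sub_eq_add_neg] at this
          calc _ ≤ ω * _ := mul_le_mul_of_nonneg_left this hω
            _ = _ := by ring
      _ ≤ 2 ^ (2 * (q + 1) - 1) * (1 + 1) := by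
          rw [← Finset.mul_sum, Finset.sum_add_distrib]
          gcongr
          exact hφp _
      _ = 4 ^ (q + 1) := by
          have : 2 * (q + 1) - 1 = 2 * q + 1 := by omega
          rw [this, pow_succ, pow_mul]; norm_num; ring
  obtain ⟨c, hc⟩ := greedy ω hω Y θ hθ hθ1 hmean q 4 (by norm_num) hY k
  refine ⟨c, ?_⟩
  have hk' : (0 : ℝ) < k := by exact_mod_cast hk
  have e : ∀ j, (1 / k) * (∑ r, sg (c r).2 * φ (c r).1 j) - ∑ l, v l * φ l j
      = (1 / k) * ∑ r, Y (c r) j := by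
    intro j
    simp only [hYd, Finset.sum_sub_distrib, Finset.sum_const, Finset.card_univ, Fintype.card_fin,
      nsmul_eq_mul]
    field_simp
  simp_rw [e, mul_pow]
  calc _ = (1 / (k : ℝ) ^ 2) ^ (q + 1) * ∑ j, ω * (∑ r, Y (c r) j) ^ (2 * (q + 1)) := by
        rw [Finset.mul_sum]
        refine Finset.sum_congr rfl fun j _ => ?_
        rw [pow_mul (1 / (k : ℝ))]; ring
    _ ≤ (1 / (k : ℝ) ^ 2) ^ (q + 1) * (7 * (q + 1) * (k + 1) * 4) ^ (q + 1) := by gcongr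
    _ = ((1 / (k : ℝ) ^ 2) * (7 * (q + 1) * (k + 1) * 4)) ^ (q + 1) := (mul_pow _ _ _).symm
    _ ≤ _ := by
        gcongr
        have h1 : (1 : ℝ) ≤ k := by exact_mod_cast hk
        rw [div_mul_eq_mul_div, div_le_div_iff₀ (by positivity) hk']
        have : (k : ℝ) + 1 ≤ 2 * k := by linarith
        have hq : (0 : ℝ) ≤ q := Nat.cast_nonneg q
        calc _ = 28 * (q + 1) * k * (k + 1 : ℝ) := by ring
          _ ≤ 28 * (q + 1) * k * (2 * k : ℝ) := by gcongr
          _ = _ := by ring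

lemma cover {J : Type*} [Fintype J] {m : ℕ} (hm : 0 < m) (a : J → Fin m → ℝ) (K Λ r : ℝ) (hK : 0 < K)
    (hΛ : 0 < Λ) (hr : 0 < r) (haK : ∀ j l, |a j l| ≤ K) (haΛ : ∀ l, ∑ j, a j l ^ 2 ≤ Λ)
    (N : Finset (Fin m → ℝ)) (hN : ∀ x ∈ N, ∑ l, |x l| ≤ r) (q k : ℕ) (hk : 0 < k) :
    ∃ π : (Fin m → ℝ) → (Fin m → ℝ), (∀ x ∈ N, π x ∈ N) ∧
      (∀ A ⊆ N, (A.image π).card ≤ (2 * m) ^ k) ∧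
      ∀ x ∈ N, ∑ j, (∑ l, x l * a j l - ∑ l, π x l * a j l) ^ (2 * (q + 1)) ≤
        (Λ / K ^ 2) * (K ^ 2 * r ^ 2 * (224 * (q + 1) / k)) ^ (q + 1) := by
  set ω := K ^ 2 / Λ with hω
  have hω0 : 0 < ω := by positivity
  set φ : Fin m → J → ℝ := fun l j => a j l / K with hφ
  have h1 : ∀ l j, |φ l j| ≤ 1 := by
    intro l j
    simp only [hφ]
    rw [abs_div, abs_of_pos hK, div_le_one hK]; exact haK j l
  have h2 : ∀ l, ∑ j, ω * φ l j ^ 2 ≤ 1 := by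
    intro l
    have : ∑ j, ω * φ l j ^ 2 = (∑ j, a j l ^ 2) / Λ := by
      rw [Finset.sum_div]
      refine Finset.sum_congr rfl fun j _ => ?_
      simp only [hω, hφ]; field_simp
    rw [this, div_le_one hΛ]; exact haΛ l
  have hex : ∀ x : Fin m → ℝ, ∃ c : Fin k → Fin m × Bool, x ∈ N →
      ∑ j, ω * ((1 / k) * (∑ r, sg (c r).2 * φ (c r).1 j) - ∑ l, (x l / r) * φ l j) ^ (2 * (q + 1))
        ≤ (56 * (q + 1) / k) ^ (q + 1) := by
    intro x
    by_cases hx : x ∈ N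
    · obtain ⟨c, hc⟩ := maurey hm ω hω0.le φ h1 h2 (fun l => x l / r) (by
        simp only [abs_div, abs_of_pos hr]
        rw [← Finset.sum_div, div_le_one hr]; exact hN x hx) q k hk
      exact ⟨c, fun _ => hc⟩
    · exact ⟨fun _ => (⟨0, hm⟩, true), fun h => absurd h hx⟩
  choose code hcode using hex
  have hrep : ∀ c : Fin k → Fin m × Bool, ∃ y : Fin m → ℝ, (∃ x ∈ N, code x = c) → y ∈ N ∧ code y = c := by
    intro c
    by_cases h : ∃ x ∈ N, code x = c
    · obtain ⟨x, hx, hc⟩ := h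
      exact ⟨x, fun _ => ⟨hx, hc⟩⟩
    · exact ⟨0, fun h' => absurd h' h⟩
  choose rep hrep using hrep
  refine ⟨fun x => rep (code x), fun x hx => (hrep (code x) ⟨x, hx, rfl⟩).1, ?_, ?_⟩
  · intro A _
    calc (A.image fun x => rep (code x)).card ≤ (Finset.univ.image rep).card := by
          apply Finset.card_le_card
          intro y hy
          obtain ⟨x, _, rfl⟩ := Finset.mem_image.1 hy
          exact Finset.mem_image.2 ⟨code x, Finset.mem_univ _, rfl⟩
      _ ≤ (Finset.univ : Finset (Fin k → Fin m × Bool)).card := Finset.card_image_le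
      _ = (2 * m) ^ k := by simp [mul_comm]
  · intro x hx
    obtain ⟨hyN, hyc⟩ := hrep (code x) ⟨x, hx, rfl⟩
    set y := rep (code x) with hy
    have hev : Even (2 * (q + 1)) := even_two_mul _
    have b1 := hcode x hx
    have b2 := hcode y hyN
    rw [hyc] at b2
    set P : J → ℝ := fun j => (1 / k) * (∑ r, sg (code x r).2 * φ (code x r).1 j) with hP
    have key : ∑ j, ω * ((∑ l, x l * a j l - ∑ l, y l * a j l) / (r * K)) ^ (2 * (q + 1)) ≤
        (224 * (q + 1) / k) ^ (q + 1) := by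
      have ee : ∀ (x : Fin m → ℝ) j, ∑ l, (x l / r) * φ l j = (∑ l, x l * a j l) / (r * K) := by
        intro x j
        rw [Finset.sum_div]
        refine Finset.sum_congr rfl fun l _ => ?_
        simp only [hφ]; field_simp
      simp only [ee] at b1 b2
      calc _ ≤ ∑ j, 2 ^ (2 * (q + 1) - 1) * (ω * (P j - (∑ l, x l * a j l) / (r * K)) ^ (2 * (q + 1))
            + ω * (P j - (∑ l, y l * a j l) / (r * K)) ^ (2 * (q + 1))) := by
            refine Finset.sum_le_sum fun j _ => ?_
            have := hev.add_pow_le (a := -(P j - (∑ l, x l * a j l) / (r * K)))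
              (b := P j - (∑ l, y l * a j l) / (r * K))
            rw [hev.neg_pow] at this
            have e : (∑ l, x l * a j l - ∑ l, y l * a j l) / (r * K) =
              -(P j - (∑ l, x l * a j l) / (r * K)) + (P j - (∑ l, y l * a j l) / (r * K)) := by ring
            rw [e]
            calc _ ≤ ω * _ := mul_le_mul_of_nonneg_left this hω0.le
              _ = _ := by ring
        _ ≤ 2 ^ (2 * (q + 1) - 1) * ((56 * (q + 1) / k) ^ (q + 1) + (56 * (q + 1) / k) ^ (q + 1)) := by
            rw [← Finset.mul_sum, Finset.sum_add_distrib]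
            gcongr
        _ = (4 * (56 * (q + 1) / k)) ^ (q + 1) := by
            have : 2 * (q + 1) - 1 = 2 * q + 1 := by omega
            rw [this, mul_pow, pow_succ, pow_mul]; norm_num; ring
        _ = _ := by ring
    have e : ∑ j, (∑ l, x l * a j l - ∑ l, y l * a j l) ^ (2 * (q + 1)) =
        (Λ / K ^ 2) * ((K ^ 2 * r ^ 2) ^ (q + 1) *
          ∑ j, ω * ((∑ l, x l * a j l - ∑ l, y l * a j l) / (r * K)) ^ (2 * (q + 1))) := by
      rw [Finset.mul_sum, Finset.mul_sum]
      refine Finset.sum_congr rfl fun j _ => ?_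
      rw [div_pow, pow_mul (r * K), mul_pow r K, hω]
      have : (K ^ 2 * r ^ 2) ^ (q + 1) = (r ^ 2 * K ^ 2) ^ (q + 1) := by ring
      rw [this]
      field_simp
    rw [e, mul_pow (K ^ 2 * r ^ 2)]
    gcongr


lemma wpow {J : Type*} [Fintype J] (w z : J → ℝ) (hw : ∀ j, 0 ≤ w j) (hz : ∀ j, 0 ≤ z j) (q : ℕ) :
    (∑ j, w j * z j) ^ (q + 1) ≤ (∑ j, w j) ^ q * ∑ j, w j * z j ^ (q + 1) := by
  set W := ∑ j, w j with hW
  have hW0 : 0 ≤ W := Finset.sum_nonneg fun j _ => hw j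
  rcases hW0.eq_or_lt with h | h
  · have hz' : ∀ j, w j = 0 := by
      intro j
      exact (Finset.sum_eq_zero_iff_of_nonneg (fun j _ => hw j)).1 (hW ▸ h.symm) j (Finset.mem_univ j)
    simp [hz']
  · have := Real.pow_arith_mean_le_arith_mean_pow Finset.univ (fun j => w j / W) z
      (fun j _ => div_nonneg (hw j) hW0) (by rw [← Finset.sum_div, ← hW, div_self h.ne'])
      (fun j _ => hz j) (q + 1)
    have e1 : ∑ j, w j / W * z j = (∑ j, w j * z j) / W := by
      rw [Finset.sum_div]; exact Finset.sum_congr rfl fun j _ => by ring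
    have e2 : ∑ j, w j / W * z j ^ (q + 1) = (∑ j, w j * z j ^ (q + 1)) / W := by
      rw [Finset.sum_div]; exact Finset.sum_congr rfl fun j _ => by ring
    rw [e1, e2, div_pow, div_le_div_iff₀ (by positivity) h] at this
    refine le_of_mul_le_mul_right ?_ h
    refine this.trans (le_of_eq ?_)
    ring

lemma var_J {J : Type*} [Fintype J] (f h : J → ℝ) (K r Λ : ℝ) (s q k : ℕ) (hK : 0 < K) (hr : 0 < r)
    (hrs : r ^ 2 = s) (hs : s ≤ 2 ^ (q + 1)) (hΛ : 0 < Λ) (hk : 0 < k)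
    (hf : ∀ j, |f j| ≤ K * r) (hh : ∀ j, |h j| ≤ K * r) (hf2 : ∑ j, f j ^ 2 ≤ Λ)
    (hh2 : ∑ j, h j ^ 2 ≤ Λ)
    (hd : ∑ j, (f j - h j) ^ (2 * (q + 1)) ≤
        (Λ / K ^ 2) * (K ^ 2 * r ^ 2 * (224 * (q + 1) / k)) ^ (q + 1)) :
    ∑ j, (f j ^ 2 - h j ^ 2) ^ 2 ≤ 1792 * Λ * K ^ 2 * s * (q + 1) / k := by
  have hk' : (0 : ℝ) < k := by exact_mod_cast hk
  have e : ∑ j, (f j ^ 2 - h j ^ 2) ^ 2 = ∑ j, (f j + h j) ^ 2 * (f j - h j) ^ 2 :=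
    Finset.sum_congr rfl fun j _ => by ring
  rw [e]
  have h1 := wpow (fun j => (f j + h j) ^ 2) (fun j => (f j - h j) ^ 2) (fun j => sq_nonneg _)
    (fun j => sq_nonneg _) q
  refine le_of_pow_le_pow_left₀ (Nat.succ_ne_zero q) (by positivity) (h1.trans ?_)
  have hw1 : ∑ j, (f j + h j) ^ 2 ≤ 4 * Λ := by
    calc ∑ j, (f j + h j) ^ 2 ≤ ∑ j, (2 * f j ^ 2 + 2 * h j ^ 2) := by
          refine Finset.sum_le_sum fun j _ => ?_
          nlinarith [sq_nonneg (f j - h j)]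
      _ = 2 * ∑ j, f j ^ 2 + 2 * ∑ j, h j ^ 2 := by
          rw [Finset.sum_add_distrib, Finset.mul_sum, Finset.mul_sum]
      _ ≤ _ := by linarith
  have hw2 : ∀ j, (f j + h j) ^ 2 ≤ 4 * K ^ 2 * s := by
    intro j
    have h3 : |f j + h j| ≤ 2 * (K * r) := (abs_add_le _ _).trans (by linarith [hf j, hh j])
    rw [← sq_abs, ← hrs]
    calc |f j + h j| ^ 2 ≤ (2 * (K * r)) ^ 2 := by gcongr
      _ = _ := by ring
  calc (∑ j, (f j + h j) ^ 2) ^ q * ∑ j, (f j + h j) ^ 2 * ((f j - h j) ^ 2) ^ (q + 1)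
      ≤ (4 * Λ) ^ q * ∑ j, (4 * K ^ 2 * s) * (f j - h j) ^ (2 * (q + 1)) := by
        gcongr with j
        · exact hw2 j
        · rw [pow_mul]
    _ = (4 * Λ) ^ q * ((4 * K ^ 2 * s) * ∑ j, (f j - h j) ^ (2 * (q + 1))) := by
        rw [← Finset.mul_sum]
    _ ≤ (4 * Λ) ^ q * ((4 * K ^ 2 * s) *
        ((Λ / K ^ 2) * (K ^ 2 * r ^ 2 * (224 * (q + 1) / k)) ^ (q + 1))) := by gcongr
    _ = s * (4 * Λ * (K ^ 2 * s * (224 * (q + 1) / k))) ^ (q + 1) := by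
        rw [mul_pow (4 * Λ), pow_succ (4 * Λ), hrs]
        generalize (K ^ 2 * s * (224 * (q + 1) / k)) ^ (q + 1) = X
        generalize (4 * Λ) ^ q = Z
        field_simp
    _ ≤ (2 : ℝ) ^ (q + 1) * (4 * Λ * (K ^ 2 * s * (224 * (q + 1) / k))) ^ (q + 1) := by
        gcongr; exact_mod_cast hs
    _ = (2 * (4 * Λ * (K ^ 2 * s * (224 * (q + 1) / k)))) ^ (q + 1) := (mul_pow _ _ _).symm
    _ = _ := by congr 1; ring

noncomputable def ff {m : ℕ} (x : Fin m → ℝ) (a : Fin m → ℝ) : ℝ := ∑ l, x l * a l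

lemma ff_bd {m : ℕ} (x a : Fin m → ℝ) (K r : ℝ) (hK : 0 < K) (ha : ∀ l, |a l| ≤ K) (hx : ∑ l, |x l| ≤ r) :
    |ff x a| ≤ K * r := by
  unfold ff
  calc |∑ l, x l * a l| ≤ ∑ l, |x l * a l| := Finset.abs_sum_le_sum_abs _ _
    _ ≤ ∑ l, |x l| * K := by
      refine Finset.sum_le_sum fun l _ => ?_
      rw [abs_mul]; exact mul_le_mul_of_nonneg_left (ha l) (abs_nonneg _)
    _ = K * ∑ l, |x l| := by rw [← Finset.sum_mul, mul_comm]
    _ ≤ _ := by gcongr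

noncomputable def GG {n m : ℕ} (a b : Fin n → Fin m → ℝ) (ε : Fin n → Bool) (x : Fin m → ℝ) : ℝ :=
  ∑ j, sg (ε j) * (ff x (a j) ^ 2 - ff x (b j) ^ 2)

open Classical in
lemma chain {n m s q k0 : ℕ} (hm : 2 ≤ m) (hs0 : 0 < s) (hs : s ≤ 2 ^ (q + 1)) (hk0 : 0 < k0)
    (a b : Fin n → Fin m → ℝ) (K r Λ : ℝ) (hK : 0 < K) (hr : 0 < r) (hrs : r ^ 2 = s) (hΛ : 0 < Λ)
    (ha : ∀ j l, |a j l| ≤ K) (hb : ∀ j l, |b j l| ≤ K)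
    (N : Finset (Fin m → ℝ)) (hN : ∀ x ∈ N, ∑ l, |x l| ≤ r)
    (hN2 : ∀ x ∈ N, ∑ j, (ff x (a j) ^ 2 + ff x (b j) ^ 2) ≤ Λ)
    (hl : ∀ l, ∑ j, (a j l ^ 2 + b j l ^ 2) ≤ Λ)
    (u0 u E : ℝ) (hu0 : 0 ≤ u0) (hu : 0 ≤ u)
    (hbase : (m : ℝ) ^ (6 * k0) * (2 * Real.exp (-(u0 ^ 2 / (2 * (K ^ 2 * s * Λ))))) ≤ E)
    (hstep : ∀ i : ℕ, i < q + 1 → (m : ℝ) ^ (12 * (2 ^ i * k0)) *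
      (2 * Real.exp (-(u ^ 2 / (2 * (3584 * Λ * K ^ 2 * s * (q + 1) / (2 ^ i * k0 : ℕ)))))) ≤ E) :
    ∀ i : ℕ, i ≤ q + 1 → ∀ A ⊆ N, A.card ≤ m ^ (6 * (2 ^ i * k0)) →
      (((Finset.univ : Finset (Fin n → Bool)).filter
        (fun ε => ∃ x ∈ A, u0 + i * u < |GG a b ε x|)).card : ℝ) ≤ 2 ^ n * ((i + 1) * E) := by
  have hs' : (0 : ℝ) < s := by exact_mod_cast hs0
  intro i
  induction i with
  | zero =>
    intro _ A hA hcard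
    have hsub : (Finset.univ : Finset (Fin n → Bool)).filter (fun ε => ∃ x ∈ A, u0 + (0 : ℕ) * u < |GG a b ε x|)
        ⊆ A.biUnion fun x => (Finset.univ : Finset (Fin n → Bool)).filter (fun ε => u0 < |GG a b ε x|) := by
      intro ε hε
      obtain ⟨x, hx, h⟩ := (Finset.mem_filter.1 hε).2
      refine Finset.mem_biUnion.2 ⟨x, hx, Finset.mem_filter.2 ⟨Finset.mem_univ _, ?_⟩⟩
      simpa using h
    have h1 : ∀ x ∈ A, (((Finset.univ : Finset (Fin n → Bool)).filter (fun ε => u0 < |GG a b ε x|)).card : ℝ)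
        ≤ 2 ^ n * (2 * Real.exp (-(u0 ^ 2 / (2 * (K ^ 2 * s * Λ))))) := by
      intro x hx
      refine hoeff n _ _ u0 (by positivity) hu0 ?_
      calc ∑ j, (ff x (a j) ^ 2 - ff x (b j) ^ 2) ^ 2
          ≤ ∑ j, K ^ 2 * s * (ff x (a j) ^ 2 + ff x (b j) ^ 2) := by
            refine Finset.sum_le_sum fun j _ => ?_
            have b1 := ff_bd x (a j) K r hK (ha j) (hN x (hA hx))
            have b2 := ff_bd x (b j) K r hK (hb j) (hN x (hA hx))
            have c1 : ff x (a j) ^ 2 ≤ K ^ 2 * s := by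
              rw [← hrs, ← mul_pow, ← sq_abs]; gcongr
            have c2 : ff x (b j) ^ 2 ≤ K ^ 2 * s := by
              rw [← hrs, ← mul_pow, ← sq_abs]; gcongr
            nlinarith [sq_nonneg (ff x (a j)), sq_nonneg (ff x (b j)),
              mul_nonneg (sq_nonneg (ff x (a j))) (sq_nonneg (ff x (b j)))]
        _ = K ^ 2 * s * ∑ j, (ff x (a j) ^ 2 + ff x (b j) ^ 2) := by rw [Finset.mul_sum]
        _ ≤ _ := by gcongr; exact hN2 x (hA hx)
    calc _ ≤ ((A.biUnion fun x => (Finset.univ : Finset (Fin n → Bool)).filter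
          (fun ε => u0 < |GG a b ε x|)).card : ℝ) := by
          exact_mod_cast Finset.card_le_card hsub
      _ ≤ ∑ x ∈ A, (((Finset.univ : Finset (Fin n → Bool)).filter (fun ε => u0 < |GG a b ε x|)).card : ℝ) := by
          exact_mod_cast Finset.card_biUnion_le
      _ ≤ ∑ x ∈ A, 2 ^ n * (2 * Real.exp (-(u0 ^ 2 / (2 * (K ^ 2 * s * Λ))))) := Finset.sum_le_sum h1
      _ = A.card * (2 ^ n * (2 * Real.exp (-(u0 ^ 2 / (2 * (K ^ 2 * s * Λ)))))) := by
          rw [Finset.sum_const, nsmul_eq_mul]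
      _ ≤ (m : ℝ) ^ (6 * k0) * (2 ^ n * (2 * Real.exp (-(u0 ^ 2 / (2 * (K ^ 2 * s * Λ)))))) := by
          gcongr
          have : A.card ≤ m ^ (6 * k0) := by simpa using hcard
          exact_mod_cast this
      _ = 2 ^ n * ((m : ℝ) ^ (6 * k0) * (2 * Real.exp (-(u0 ^ 2 / (2 * (K ^ 2 * s * Λ)))))) := by ring
      _ ≤ 2 ^ n * (((0 : ℕ) + 1) * E) := by
          simp only [Nat.cast_zero, zero_add, one_mul]
          gcongr
  | succ i ih =>
    intro hi A hA hcard
    set k := 2 ^ i * k0 with hk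
    have hkp : 0 < k := by positivity
    set aa : Fin n ⊕ Fin n → Fin m → ℝ := Sum.elim a b with haa
    have haaK : ∀ j l, |aa j l| ≤ K := by
      rintro (j | j) l
      · exact ha j l
      · exact hb j l
    have haaΛ : ∀ l, ∑ j, aa j l ^ 2 ≤ Λ := by
      intro l
      rw [Fintype.sum_sum_type, ← Finset.sum_add_distrib]
      exact hl l
    obtain ⟨π, hπN, hπc, hπ⟩ := cover (by omega) aa K Λ r hK hΛ hr haaK haaΛ N hN q k hkp
    have hA' : A.image π ⊆ N := by
      intro y hy
      obtain ⟨x, hx, rfl⟩ := Finset.mem_image.1 hy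
      exact hπN x (hA hx)
    have hc' : (A.image π).card ≤ m ^ (6 * k) := by
      refine (hπc A hA).trans ?_
      calc (2 * m) ^ k ≤ (m ^ 6) ^ k := by
            gcongr
            calc 2 * m ≤ m * m := by gcongr
              _ = m ^ 2 := by ring
              _ ≤ m ^ 6 := Nat.pow_le_pow_right (by omega) (by omega)
        _ = _ := by rw [← pow_mul]
    have ih' := ih (by omega) (A.image π) hA' hc'
    have hsub : (Finset.univ : Finset (Fin n → Bool)).filter
          (fun ε => ∃ x ∈ A, u0 + ((i + 1 : ℕ) : ℝ) * u < |GG a b ε x|)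
        ⊆ ((Finset.univ : Finset (Fin n → Bool)).filter
          (fun ε => ∃ x ∈ A.image π, u0 + (i : ℝ) * u < |GG a b ε x|)) ∪
          A.biUnion fun x => (Finset.univ : Finset (Fin n → Bool)).filter
            (fun ε => u < |GG a b ε x - GG a b ε (π x)|) := by
      intro ε hε
      obtain ⟨x, hx, h⟩ := (Finset.mem_filter.1 hε).2
      by_cases hd : u < |GG a b ε x - GG a b ε (π x)|
      · exact Finset.mem_union_right _ (Finset.mem_biUnion.2
          ⟨x, hx, Finset.mem_filter.2 ⟨Finset.mem_univ _, hd⟩⟩)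
      · refine Finset.mem_union_left _ (Finset.mem_filter.2 ⟨Finset.mem_univ _,
          π x, Finset.mem_image_of_mem _ hx, ?_⟩)
        have := abs_sub_abs_le_abs_sub (GG a b ε x) (GG a b ε (π x))
        push_cast at h
        linarith
    set V : ℝ := 3584 * Λ * K ^ 2 * s * (q + 1) / (k : ℕ) with hV
    have hkr : (0 : ℝ) < k := by exact_mod_cast hkp
    have h1 : ∀ x ∈ A, (((Finset.univ : Finset (Fin n → Bool)).filter
          (fun ε => u < |GG a b ε x - GG a b ε (π x)|)).card : ℝ)
        ≤ 2 ^ n * (2 * Real.exp (-(u ^ 2 / (2 * V)))) := by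
      intro x hx
      have hxN := hA hx
      have hyN := hπN x hxN
      have e : ∀ ε, GG a b ε x - GG a b ε (π x) = ∑ j, sg (ε j) *
          ((ff x (a j) ^ 2 - ff x (b j) ^ 2) - (ff (π x) (a j) ^ 2 - ff (π x) (b j) ^ 2)) := by
        intro ε
        unfold GG
        rw [← Finset.sum_sub_distrib]
        exact Finset.sum_congr rfl fun j _ => by ring
      simp only [e]
      refine hoeff n _ _ u (by positivity) hu ?_
      have hv := var_J (fun j => ff x (aa j)) (fun j => ff (π x) (aa j)) K r Λ s q k hK hr hrs hs hΛ hkp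
        (fun j => ff_bd _ _ K r hK (haaK j) (hN x hxN)) (fun j => ff_bd _ _ K r hK (haaK j) (hN _ hyN))
        (by rw [Fintype.sum_sum_type, ← Finset.sum_add_distrib]; exact hN2 x hxN)
        (by rw [Fintype.sum_sum_type, ← Finset.sum_add_distrib]; exact hN2 _ hyN)
        (hπ x hxN)
      rw [Fintype.sum_sum_type, ← Finset.sum_add_distrib] at hv
      simp only [haa, Sum.elim_inl, Sum.elim_inr] at hv
      calc _ ≤ ∑ j, 2 * ((ff x (a j) ^ 2 - ff (π x) (a j) ^ 2) ^ 2
            + (ff x (b j) ^ 2 - ff (π x) (b j) ^ 2) ^ 2) := by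
            refine Finset.sum_le_sum fun j _ => ?_
            nlinarith [sq_nonneg ((ff x (a j) ^ 2 - ff (π x) (a j) ^ 2)
              + (ff x (b j) ^ 2 - ff (π x) (b j) ^ 2))]
        _ ≤ 2 * (1792 * Λ * K ^ 2 * s * (q + 1) / k) := by
            rw [← Finset.mul_sum]; gcongr
        _ = V := by rw [hV]; ring
    have hst := hstep i (by omega)
    calc _ ≤ ((((Finset.univ : Finset (Fin n → Bool)).filter
          (fun ε => ∃ x ∈ A.image π, u0 + (i : ℝ) * u < |GG a b ε x|)) ∪
          A.biUnion fun x => (Finset.univ : Finset (Fin n → Bool)).filter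
            (fun ε => u < |GG a b ε x - GG a b ε (π x)|)).card : ℝ) := by
          exact_mod_cast Finset.card_le_card hsub
      _ ≤ (((Finset.univ : Finset (Fin n → Bool)).filter
          (fun ε => ∃ x ∈ A.image π, u0 + (i : ℝ) * u < |GG a b ε x|)).card : ℝ) +
          ((A.biUnion fun x => (Finset.univ : Finset (Fin n → Bool)).filter
            (fun ε => u < |GG a b ε x - GG a b ε (π x)|)).card : ℝ) := by
          exact_mod_cast Finset.card_union_le _ _
      _ ≤ 2 ^ n * ((i + 1) * E) + ∑ x ∈ A, (((Finset.univ : Finset (Fin n → Bool)).filter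
            (fun ε => u < |GG a b ε x - GG a b ε (π x)|)).card : ℝ) := by
          refine add_le_add ih' ?_
          exact_mod_cast Finset.card_biUnion_le
      _ ≤ 2 ^ n * ((i + 1) * E) + ∑ x ∈ A, 2 ^ n * (2 * Real.exp (-(u ^ 2 / (2 * V)))) :=
          add_le_add le_rfl (Finset.sum_le_sum h1)
      _ = 2 ^ n * ((i + 1) * E) + A.card * (2 ^ n * (2 * Real.exp (-(u ^ 2 / (2 * V))))) := by
          rw [Finset.sum_const, nsmul_eq_mul]
      _ ≤ 2 ^ n * ((i + 1) * E) + (m : ℝ) ^ (12 * k) * (2 ^ n * (2 * Real.exp (-(u ^ 2 / (2 * V))))) := by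
          gcongr
          have : A.card ≤ m ^ (12 * k) := hcard.trans (le_of_eq (by rw [hk, pow_succ]; ring_nf))
          exact_mod_cast this
      _ = 2 ^ n * ((i + 1) * E) + 2 ^ n * ((m : ℝ) ^ (12 * k) * (2 * Real.exp (-(u ^ 2 / (2 * V))))) := by
          ring
      _ ≤ 2 ^ n * ((i + 1) * E) + 2 ^ n * E := by gcongr
      _ = _ := by push_cast; ring


lemma clog_bd (s q : ℕ) (hs : 2 ≤ s) (hq : Nat.clog 2 s = q + 1) (lam : ℝ) (hlam : Real.log s ^ 3 ≤ lam) :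
    ((q : ℝ) + 1) ^ 3 ≤ 25 * lam := by
  have h1 : 2 ^ q < s := by
    have := Nat.pow_pred_clog_lt_self (b := 2) (by norm_num) (x := s) (by omega)
    simpa [hq] using this
  have h2 : (q : ℝ) * Real.log 2 ≤ Real.log s := by
    rw [← Real.log_pow]
    apply Real.log_le_log (by positivity)
    exact_mod_cast h1.le
  have h3 : Real.log 2 ≤ Real.log s := by
    apply Real.log_le_log (by positivity)
    exact_mod_cast hs
  have h4 := Real.log_two_gt_d9
  have h5 : (q : ℝ) + 1 ≤ 2.89 * Real.log s := by
    have hq0 : (0 : ℝ) ≤ q := Nat.cast_nonneg q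
    nlinarith
  calc ((q : ℝ) + 1) ^ 3 ≤ (2.89 * Real.log s) ^ 3 := by gcongr
    _ = 2.89 ^ 3 * Real.log s ^ 3 := by ring
    _ ≤ 25 * Real.log s ^ 3 := by
      have : 0 ≤ Real.log s ^ 3 := by
        apply pow_nonneg; linarith
      norm_num; linarith
    _ ≤ _ := by gcongr

lemma tail_bd (m k a b k0 : ℕ) (hm : 2 ≤ m) (hk0 : 0 < k0) (hk : k0 ≤ k) (hb : a + 5 ≤ b) (X : ℝ)
    (hX : b * k * Real.log m ≤ X) :
    (m : ℝ) ^ (a * k) * (2 * Real.exp (-X)) ≤ 1 / (m : ℝ) ^ (4 * k0) := by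
  have hm0 : (0 : ℝ) < m := by positivity
  have hm1 : (1 : ℝ) ≤ m := by exact_mod_cast (by omega : 1 ≤ m)
  have hm2 : (2 : ℝ) ≤ m := by exact_mod_cast hm
  have h1 : Real.exp (-X) ≤ 1 / (m : ℝ) ^ (b * k) := by
    calc Real.exp (-X) ≤ Real.exp (-(b * k * Real.log m)) := by gcongr
      _ = 1 / (m : ℝ) ^ (b * k) := by
        rw [Real.exp_neg, ← Nat.cast_mul, Real.exp_nat_mul, Real.exp_log hm0, one_div]
  calc (m : ℝ) ^ (a * k) * (2 * Real.exp (-X)) ≤ (m : ℝ) ^ (a * k) * (m * (1 / (m : ℝ) ^ (b * k))) := by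
        gcongr
    _ = (m : ℝ) ^ (a * k + 1) / (m : ℝ) ^ (b * k) := by rw [pow_succ]; ring
    _ ≤ 1 / (m : ℝ) ^ (4 * k0) := by
        rw [div_le_div_iff₀ (by positivity) (by positivity), one_mul, ← pow_add]
        apply pow_le_pow_right₀ hm1
        nlinarith

open Classical in
lemma core {n m s : ℕ} (hm : 2 ≤ m) (hs : 2 ≤ s) (hsm : s ≤ m) (K δ lam M : ℝ) (hK : 1 ≤ K)
    (hδ : 0 < δ) (hlam : Real.log s ^ 3 ≤ lam)
    (hn : 2000000000 / δ ^ 2 * K ^ 2 * s * lam * Real.log m ≤ n) (hM : 1 ≤ M)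
    (a b : Fin n → Fin m → ℝ)
    (ha : ∀ j l, |a j l| ≤ K) (hb : ∀ j l, |b j l| ≤ K)
    (N : Finset (Fin m → ℝ)) (hN : ∀ x ∈ N, ∑ l, |x l| ≤ Real.sqrt s) (hNc : N.card ≤ m ^ (6 * s))
    (hN2 : ∀ x ∈ N, ∑ j, (ff x (a j) ^ 2 + ff x (b j) ^ 2) ≤ n * M)
    (hl : ∀ l, ∑ j, (a j l ^ 2 + b j l ^ 2) ≤ n * M) :
    (((Finset.univ : Finset (Fin n → Bool)).filter
        (fun ε => ∃ x ∈ N, δ / 10 * n * Real.sqrt M < |GG a b ε x|)).card : ℝ)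
        ≤ 2 ^ n * ((m : ℝ) ^ (-lam) / 2) := by
  have hlogm : 0 < Real.log m := Real.log_pos (by exact_mod_cast (by omega : 1 < m))
  have hlog2 := Real.log_two_gt_d9
  have hlogs : Real.log 2 ≤ Real.log s := by
    apply Real.log_le_log (by positivity)
    exact_mod_cast hs
  have hlam4 : 1 / 4 ≤ lam := by
    have : (0.69 : ℝ) ^ 3 ≤ Real.log s ^ 3 := by gcongr; linarith
    norm_num at this
    linarith
  have hlam0 : 0 < lam := by linarith
  have hs' : (0 : ℝ) < s := by positivity
  have hn0 : (0 : ℝ) < n := lt_of_lt_of_le (by positivity) hn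
  obtain ⟨q, hq⟩ : ∃ q, Nat.clog 2 s = q + 1 :=
    ⟨Nat.clog 2 s - 1, by have := Nat.clog_pos (b := 2) (by norm_num) hs; omega⟩
  have hsq : s ≤ 2 ^ (q + 1) := hq ▸ Nat.le_pow_clog (by norm_num) s
  have hp3 := clog_bd s q hs hq lam hlam
  have hqs : q + 1 ≤ s := by
    have h1 : 2 ^ q < s := by
      have := Nat.pow_pred_clog_lt_self (b := 2) (by norm_num) (x := s) (by omega)
      simpa [hq] using this
    have := Nat.lt_two_pow_self (n := q)
    omega
  set k0 := ⌈lam⌉₊ with hk0d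
  have hk0 : 0 < k0 := Nat.ceil_pos.2 hlam0
  have hk0l : lam ≤ k0 := Nat.le_ceil _
  have hk0u : (k0 : ℝ) ≤ 5 * lam := by
    have := Nat.ceil_lt_add_one hlam0.le
    linarith
  have hM0 : 0 < M := by linarith
  have hK0 : 0 < K := by linarith
  have hsM : Real.sqrt M ^ 2 = M := Real.sq_sqrt hM0.le
  have hn' : 2000000000 * lam * Real.log m ≤ δ ^ 2 * n / (K ^ 2 * s) := by
    rw [le_div_iff₀ (by positivity)]
    have := mul_le_mul_of_nonneg_left hn (by positivity : 0 ≤ δ ^ 2)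
    refine le_trans (le_of_eq ?_) this
    field_simp
  have hq1 : (0 : ℝ) < (q : ℝ) + 1 := by positivity
  have hbase : (m : ℝ) ^ (6 * k0) * (2 * Real.exp (-((δ * n * Real.sqrt M / 20) ^ 2 / (2 * (K ^ 2 * s * (n * M))))))
      ≤ 1 / (m : ℝ) ^ (4 * k0) := by
    refine tail_bd m k0 6 11 k0 hm hk0 le_rfl (by norm_num) _ ?_
    have e : (δ * n * Real.sqrt M / 20) ^ 2 / (2 * (K ^ 2 * s * (n * M))) =
        (δ ^ 2 * n / (K ^ 2 * s)) / 800 := by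
      rw [div_pow, mul_pow, hsM]; field_simp; ring
    rw [e]
    have : (k0 : ℝ) * Real.log m ≤ 5 * lam * Real.log m := by gcongr
    push_cast
    nlinarith [mul_pos hlam0 hlogm]
  have hstep : ∀ i : ℕ, i < q + 1 → (m : ℝ) ^ (12 * (2 ^ i * k0)) *
      (2 * Real.exp (-((δ * n * Real.sqrt M / (20 * (q + 1))) ^ 2 /
        (2 * (3584 * (n * M) * K ^ 2 * s * (q + 1) / (2 ^ i * k0 : ℕ)))))) ≤ 1 / (m : ℝ) ^ (4 * k0) := by
    intro i _
    set k := 2 ^ i * k0 with hk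
    have hkk : k0 ≤ k := Nat.le_mul_of_pos_left _ (by positivity)
    have hkp : (0 : ℝ) < k := by exact_mod_cast lt_of_lt_of_le hk0 hkk
    refine tail_bd m k 12 17 k0 hm hk0 hkk (by norm_num) _ ?_
    have e : (δ * n * Real.sqrt M / (20 * (q + 1))) ^ 2 /
        (2 * (3584 * (n * M) * K ^ 2 * s * (q + 1) / k)) =
        (δ ^ 2 * n / (K ^ 2 * s)) * k / (2867200 * ((q : ℝ) + 1) ^ 3) := by
      rw [div_pow, mul_pow, hsM]; field_simp; ring
    rw [e, le_div_iff₀ (by positivity)]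
    calc ((17 : ℕ) : ℝ) * k * Real.log m * (2867200 * ((q : ℝ) + 1) ^ 3)
        ≤ ((17 : ℕ) : ℝ) * k * Real.log m * (2867200 * (25 * lam)) := by gcongr
      _ ≤ (2000000000 * lam * Real.log m) * k := by
        push_cast
        nlinarith [mul_pos (mul_pos hlam0 hlogm) hkp]
      _ ≤ _ := by gcongr
  have hc := chain (n := n) (q := q) (k0 := k0) hm (by omega : 0 < s) hsq hk0 a b K (Real.sqrt s) (n * M) hK0
    (Real.sqrt_pos.2 hs') (Real.sq_sqrt hs'.le) (by positivity) ha hb N hN hN2 hl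
    (δ * n * Real.sqrt M / 20) (δ * n * Real.sqrt M / (20 * (q + 1))) (1 / (m : ℝ) ^ (4 * k0))
    (by positivity) (by positivity) hbase hstep (q + 1) le_rfl N (Finset.Subset.refl _) (by
      refine hNc.trans (Nat.pow_le_pow_right (by omega) ?_)
      have : s * 1 ≤ 2 ^ (q + 1) * k0 := Nat.mul_le_mul hsq hk0
      omega)
  have e : δ * n * Real.sqrt M / 20 + ((q + 1 : ℕ) : ℝ) * (δ * n * Real.sqrt M / (20 * (q + 1)))
      = δ / 10 * n * Real.sqrt M := by
    push_cast; field_simp; ring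
  rw [e] at hc
  refine hc.trans ?_
  gcongr
  have hm0 : (0 : ℝ) < m := by positivity
  have hm1 : (1 : ℝ) ≤ m := by exact_mod_cast (by omega : 1 ≤ m)
  have hm2 : (2 : ℝ) ≤ m := by exact_mod_cast hm
  have hqm : (q : ℝ) + 1 ≤ m := by exact_mod_cast hqs.trans hsm
  have h1 : 2 * (((q + 1 : ℕ) : ℝ) + 1) ≤ (m : ℝ) ^ 3 := by
    push_cast
    nlinarith [mul_nonneg (sub_nonneg.2 hm2) (sub_nonneg.2 hm2), mul_nonneg (mul_nonneg (sub_nonneg.2 hm2) (sub_nonneg.2 hm2)) hm0.le]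
  have h2 : (m : ℝ) ^ (-(k0 : ℝ)) ≤ (m : ℝ) ^ (-lam) :=
    Real.rpow_le_rpow_of_exponent_le hm1 (by linarith)
  rw [Real.rpow_neg hm0.le, Real.rpow_natCast] at h2
  calc (((q + 1 : ℕ) : ℝ) + 1) * (1 / (m : ℝ) ^ (4 * k0)) ≤ ((m : ℝ) ^ 3 / 2) * (1 / (m : ℝ) ^ (4 * k0)) := by
        gcongr; linarith
    _ ≤ ((m : ℝ) ^ (3 * k0) / 2) * (1 / (m : ℝ) ^ (4 * k0)) := by
        gcongr
        omega
    _ = ((m : ℝ) ^ k0)⁻¹ / 2 := by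
        have : 4 * k0 = 3 * k0 + k0 := by ring
        rw [this, pow_add]; field_simp
    _ ≤ _ := by gcongr


noncomputable def gridS (s : ℕ) : Finset ℝ :=
  (Finset.Icc (-(4 * s : ℤ)) (4 * s)).image (fun z : ℤ => (z : ℝ) / (4 * s))

lemma gridS_card (s : ℕ) : (gridS s).card ≤ 8 * s + 1 := by
  refine Finset.card_image_le.trans ?_
  rw [Int.card_Icc]; omega

open Classical in
noncomputable def netS (m s : ℕ) : Finset (Fin m → ℝ) :=
  ((Finset.powersetCard s (Finset.univ : Finset (Fin m))).biUnion
    (fun S => Fintype.piFinset (fun i => if i ∈ S then gridS s else {0}))).filter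
      (fun x => ∑ l, x l ^ 2 ≤ 1)

lemma mem_netS {m s : ℕ} (x : Fin m → ℝ) : x ∈ netS m s ↔
    (∃ S : Finset (Fin m), S.card = s ∧ (∀ i ∈ S, x i ∈ gridS s) ∧ ∀ i ∉ S, x i = 0) ∧ ∑ l, x l ^ 2 ≤ 1 := by
  classical
  unfold netS
  rw [Finset.mem_filter, Finset.mem_biUnion]
  refine and_congr_left fun _ => exists_congr fun S => ?_
  rw [Finset.mem_powersetCard_univ]
  refine and_congr_right fun _ => ?_
  rw [Fintype.mem_piFinset]
  constructor
  · intro h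
    refine ⟨fun i hi => ?_, fun i hi => ?_⟩
    · have := h i; rwa [if_pos hi] at this
    · have := h i; rw [if_neg hi] at this; simpa using this
  · rintro ⟨h1, h2⟩ i
    by_cases hi : i ∈ S
    · rw [if_pos hi]; exact h1 i hi
    · rw [if_neg hi]; simpa using h2 i hi

lemma netS_card {m s : ℕ} (hm : 2 ≤ m) (hsm : s ≤ m) : (netS m s).card ≤ m ^ (6 * s) := by
  classical
  unfold netS
  refine (Finset.card_filter_le _ _).trans ?_
  refine (Finset.card_biUnion_le).trans ?_
  have h1 : ∀ S ∈ Finset.powersetCard s (Finset.univ : Finset (Fin m)),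
      (Fintype.piFinset (fun i => if i ∈ S then gridS s else ({0} : Finset ℝ))).card ≤ (m ^ 5) ^ s := by
    intro S hS
    rw [Finset.mem_powersetCard_univ] at hS
    rw [Fintype.card_piFinset]
    have : ∀ i, (if i ∈ S then gridS s else ({0} : Finset ℝ)).card ≤ if i ∈ S then m ^ 5 else 1 := by
      intro i
      split_ifs
      · refine (gridS_card s).trans ?_
        have : 16 ≤ m ^ 4 := by
          calc 16 = 2 ^ 4 := by norm_num
            _ ≤ m ^ 4 := Nat.pow_le_pow_left hm 4
        calc 8 * s + 1 ≤ 16 * m := by omega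
          _ ≤ m ^ 4 * m := by gcongr
          _ = m ^ 5 := by ring
      · simp
    refine (Finset.prod_le_prod' fun i _ => this i).trans ?_
    rw [Finset.prod_ite_mem, Finset.univ_inter, Finset.prod_const, hS]
  refine (Finset.sum_le_sum h1).trans ?_
  rw [Finset.sum_const, Finset.card_powersetCard, Finset.card_univ, Fintype.card_fin, smul_eq_mul]
  calc m.choose s * (m ^ 5) ^ s ≤ m ^ s * (m ^ 5) ^ s := by
        gcongr; exact Nat.choose_le_pow m s
    _ = _ := by rw [← pow_mul, ← pow_add]; congr 1; ring

lemma netS_l1 {m s : ℕ} (x : Fin m → ℝ) (hx : x ∈ netS m s) : ∑ l, |x l| ≤ Real.sqrt s := by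
  obtain ⟨⟨S, hS, h1, h2⟩, h3⟩ := (mem_netS x).1 hx
  apply Real.le_sqrt_of_sq_le
  have e : ∑ l, |x l| = ∑ l ∈ S, |x l| := by
    symm
    apply Finset.sum_subset (Finset.subset_univ S)
    intro i _ hi
    simp [h2 i hi]
  rw [e]
  have := sq_sum_le_card_mul_sum_sq (s := S) (f := fun l => |x l|)
  rw [hS] at this
  refine this.trans ?_
  have h4 : ∑ l ∈ S, |x l| ^ 2 ≤ 1 := by
    simp only [sq_abs]
    exact (Finset.sum_le_univ_sum_of_nonneg fun i => sq_nonneg _).trans h3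
  calc (s : ℝ) * ∑ l ∈ S, |x l| ^ 2 ≤ s * 1 := by gcongr
    _ = s := mul_one _

lemma netS_single {m s : ℕ} (hs : 1 ≤ s) (hsm : s ≤ m) (k : Fin m) : Pi.single k (1 : ℝ) ∈ netS m s := by
  classical
  rw [mem_netS]
  have hs' : (0 : ℝ) < s := by exact_mod_cast hs
  constructor
  · obtain ⟨S, hS1, hS2⟩ := Finset.exists_superset_card_eq (s := {k}) (n := s) (by simpa using hs)
      (by simpa using hsm)
    refine ⟨S, hS2, fun i _ => ?_, fun i hi => ?_⟩
    · by_cases h : i = k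
      · subst h
        rw [Pi.single_eq_same]
        refine Finset.mem_image.2 ⟨4 * s, Finset.mem_Icc.2 ⟨by omega, le_rfl⟩, ?_⟩
        push_cast; field_simp
      · rw [Pi.single_eq_of_ne h]
        exact Finset.mem_image.2 ⟨0, Finset.mem_Icc.2 ⟨by omega, by omega⟩, by simp⟩
    · apply Pi.single_eq_of_ne
      rintro rfl
      exact hi (hS1 (Finset.mem_singleton_self _))
  · apply le_of_eq
    rw [Finset.sum_eq_single k]
    · simp
    · intro i _ hi; simp [Pi.single_eq_of_ne hi]
    · simp

lemma round0 (t h : ℝ) (hh : 0 < h) : ∃ z : ℤ, |(z : ℝ) / h| ≤ |t| ∧ |t - z / h| ≤ 1 / h := by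
  rcases le_total 0 t with ht | ht
  · refine ⟨⌊h * t⌋, ?_⟩
    have h1 := Int.floor_le (h * t)
    have h2 := Int.lt_floor_add_one (h * t)
    have h3 : (0 : ℝ) ≤ ⌊h * t⌋ := by exact_mod_cast Int.floor_nonneg.2 (by positivity)
    have h4 : (⌊h * t⌋ : ℝ) / h ≤ t := by rw [div_le_iff₀ hh]; linarith
    constructor
    · rw [abs_of_nonneg ht, abs_of_nonneg (by positivity)]; exact h4
    · rw [abs_of_nonneg (by linarith), sub_le_iff_le_add, ← add_div, le_div_iff₀ hh]; linarith
  · refine ⟨⌈h * t⌉, ?_⟩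
    have h1 := Int.le_ceil (h * t)
    have h2 := Int.ceil_lt_add_one (h * t)
    have h0 : h * t ≤ 0 := mul_nonpos_of_nonneg_of_nonpos hh.le ht
    have h3 : (⌈h * t⌉ : ℝ) ≤ 0 := by exact_mod_cast Int.ceil_le.2 (by simpa using h0)
    have h4 : t ≤ (⌈h * t⌉ : ℝ) / h := by rw [le_div_iff₀ hh]; linarith
    have h5 : (⌈h * t⌉ : ℝ) / h ≤ 0 := div_nonpos_of_nonpos_of_nonneg h3 hh.le
    constructor
    · rw [abs_of_nonpos ht, abs_of_nonpos h5]; linarith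
    · rw [abs_of_nonpos (by linarith), neg_sub, sub_le_iff_le_add]
      rw [div_le_iff₀ hh, add_mul, one_div, inv_mul_cancel₀ hh.ne']; linarith

lemma netS_approx {m s : ℕ} (hs : 2 ≤ s) (S : Finset (Fin m)) (hS : S.card = s) (x : Fin m → ℝ)
    (hxS : ∀ i ∉ S, x i = 0) (hx : ∑ l, x l ^ 2 ≤ 1) :
    ∃ y ∈ netS m s, (∀ i ∉ S, y i = 0) ∧ ∑ l, (x l - y l) ^ 2 ≤ 1 / 32 := by
  have hs' : (2 : ℝ) ≤ s := by exact_mod_cast hs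
  have hh : (0 : ℝ) < 4 * s := by linarith
  choose z hz1 hz2 using fun i => round0 (x i) (4 * s) hh
  have hy0 : ∀ i ∉ S, (z i : ℝ) / (4 * s) = 0 := by
    intro i hi
    have := hz1 i
    rw [hxS i hi, abs_zero] at this
    exact abs_eq_zero.1 (le_antisymm this (abs_nonneg _))
  refine ⟨fun i => (z i : ℝ) / (4 * s), ?_, hy0, ?_⟩
  · rw [mem_netS]
    refine ⟨⟨S, hS, fun i _ => ?_, hy0⟩, ?_⟩
    · refine Finset.mem_image.2 ⟨z i, ?_, rfl⟩
      have h1 : |x i| ≤ 1 := by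
        rw [← sq_le_one_iff_abs_le_one]
        exact (Finset.single_le_sum (f := fun l => x l ^ 2) (fun l _ => sq_nonneg _) (Finset.mem_univ i)).trans hx
      have h2 := (hz1 i).trans h1
      rw [abs_div, abs_of_pos hh, div_le_one hh] at h2
      have h3 := abs_le.1 h2
      rw [Finset.mem_Icc]
      constructor
      · have := h3.1; exact_mod_cast this
      · have := h3.2; exact_mod_cast this
    · refine le_trans (Finset.sum_le_sum fun l _ => ?_) hx
      exact sq_le_sq.2 (hz1 l)
  · have e : ∑ l, (x l - (z l : ℝ) / (4 * s)) ^ 2 = ∑ l ∈ S, (x l - (z l : ℝ) / (4 * s)) ^ 2 := by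
      symm
      apply Finset.sum_subset (Finset.subset_univ S)
      intro i _ hi
      rw [hy0 i hi, hxS i hi]; simp
    show ∑ l, (x l - (z l : ℝ) / (4 * s)) ^ 2 ≤ _
    rw [e]
    calc _ ≤ ∑ l ∈ S, (1 / (4 * s : ℝ)) ^ 2 := by
          refine Finset.sum_le_sum fun l _ => ?_
          rw [← sq_abs]
          gcongr
          exact hz2 l
      _ = s * (1 / (4 * s : ℝ)) ^ 2 := by rw [Finset.sum_const, hS, nsmul_eq_mul]
      _ = 1 / (16 * s) := by field_simp; norm_num
      _ ≤ 1 / 32 := by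
          apply one_div_le_one_div_of_le <;> linarith

noncomputable def QQ {n m : ℕ} (a : Fin n → Fin m → ℝ) (x : Fin m → ℝ) : ℝ :=
  (1 / n) * (∑ j, ff x (a j) ^ 2) - ∑ l, x l ^ 2

lemma ff_smul {m : ℕ} (t : ℝ) (x a : Fin m → ℝ) : ff (fun l => t * x l) a = t * ff x a := by
  unfold ff; rw [Finset.mul_sum]; exact Finset.sum_congr rfl fun l _ => by ring

lemma ff_lin {m : ℕ} (t r : ℝ) (x y a : Fin m → ℝ) :
    ff (fun l => t * x l + r * y l) a = t * ff x a + r * ff y a := by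
  unfold ff; rw [Finset.mul_sum, Finset.mul_sum, ← Finset.sum_add_distrib]
  exact Finset.sum_congr rfl fun l _ => by ring

lemma QQ_smul {n m : ℕ} (a : Fin n → Fin m → ℝ) (t : ℝ) (x : Fin m → ℝ) :
    QQ a (fun l => t * x l) = t ^ 2 * QQ a x := by
  unfold QQ
  simp only [ff_smul, mul_pow, ← Finset.mul_sum]
  ring

/-- with `u = x - y`, `v = x + y`: `3u + v/3 = (10/3) x - (8/3) y`, `3u - v/3 = (8/3) x - (10/3) y`. -/
lemma QQ_polar {n m : ℕ} (a : Fin n → Fin m → ℝ) (x y : Fin m → ℝ) :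
    QQ a (fun l => (10 / 3) * x l + (-8 / 3) * y l) - QQ a (fun l => (8 / 3) * x l + (-10 / 3) * y l)
      = 4 * (QQ a x - QQ a y) := by
  unfold QQ
  simp only [ff_lin]
  have e1 : ∀ (X Y : ℝ), ((10 / 3) * X + (-8 / 3) * Y) ^ 2 = ((8 / 3) * X + (-10 / 3) * Y) ^ 2 + 4 * X ^ 2 - 4 * Y ^ 2 := by
    intro X Y; ring
  simp only [e1, Finset.sum_add_distrib, Finset.sum_sub_distrib, ← Finset.mul_sum]
  ring

lemma QQ_contr {n m s : ℕ} (hs : 2 ≤ s) (a : Fin n → Fin m → ℝ) (μ c : ℝ) (hc0 : 0 ≤ c) (hμ : ∀ y ∈ netS m s, |QQ a y| ≤ μ)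
    (S : Finset (Fin m)) (hS : S.card = s)
    (hc : ∀ x : Fin m → ℝ, (∀ i ∉ S, x i = 0) → |QQ a x| ≤ c * ∑ l, x l ^ 2) :
    ∀ x : Fin m → ℝ, (∀ i ∉ S, x i = 0) → |QQ a x| ≤ (μ + c / 2) * ∑ l, x l ^ 2 := by
  have h1 : ∀ x : Fin m → ℝ, (∀ i ∉ S, x i = 0) → ∑ l, x l ^ 2 ≤ 1 → |QQ a x| ≤ μ + c / 2 := by
    intro x hxS hx
    obtain ⟨y, hyN, hyS, hxy⟩ := netS_approx hs S hS x hxS hx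
    have hy1 := ((mem_netS y).1 hyN).2
    have hp := QQ_polar a x y
    have b1 := hc (fun l => (10 / 3) * x l + (-8 / 3) * y l) (fun i hi => by simp [hxS i hi, hyS i hi])
    have b2 := hc (fun l => (8 / 3) * x l + (-10 / 3) * y l) (fun i hi => by simp [hxS i hi, hyS i hi])
    have b3 := hμ y hyN
    have e : ∑ l, ((10 / 3) * x l + (-8 / 3) * y l) ^ 2 + ∑ l, ((8 / 3) * x l + (-10 / 3) * y l) ^ 2
        ≤ 2 := by
      have : ∀ l, ((10 / 3) * x l + (-8 / 3) * y l) ^ 2 + ((8 / 3) * x l + (-10 / 3) * y l) ^ 2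
          = (160 / 9) * (x l - y l) ^ 2 + (4 / 9) * x l ^ 2 + (4 / 9) * y l ^ 2 := by
        intro l; ring
      rw [← Finset.sum_add_distrib]
      simp only [this, Finset.sum_add_distrib, ← Finset.mul_sum]
      linarith
    have b4 : |4 * (QQ a x - QQ a y)| ≤ c * 2 := by
      rw [← hp]
      refine (abs_sub _ _).trans ?_
      refine (add_le_add b1 b2).trans ?_
      rw [← mul_add]
      gcongr
    rw [abs_mul, abs_of_pos (by norm_num : (0 : ℝ) < 4)] at b4
    have := abs_sub_abs_le_abs_sub (QQ a x) (QQ a y)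
    linarith
  intro x hxS
  set w := ∑ l, x l ^ 2 with hw
  have hw0 : 0 ≤ w := Finset.sum_nonneg fun l _ => sq_nonneg _
  rcases hw0.eq_or_lt with h | h
  · have := hc x hxS
    rw [← hw, ← h, mul_zero] at this
    rw [← h, mul_zero]; exact this
  · have hsq : (Real.sqrt w)⁻¹ ^ 2 = w⁻¹ := by rw [inv_pow, Real.sq_sqrt hw0]
    have := h1 (fun l => (Real.sqrt w)⁻¹ * x l) (fun i hi => by simp [hxS i hi]) (by
      simp only [mul_pow, ← Finset.mul_sum]
      rw [hsq, ← hw, inv_mul_cancel₀ h.ne'])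
    rw [QQ_smul, hsq, abs_mul, abs_of_pos (inv_pos.2 h), inv_mul_le_iff₀ h] at this
    linarith

lemma QQ_net {n m s : ℕ} (hs : 2 ≤ s) (a : Fin n → Fin m → ℝ) (μ : ℝ) (hμ0 : 0 ≤ μ)
    (hμ : ∀ y ∈ netS m s, |QQ a y| ≤ μ)
    (S : Finset (Fin m)) (hS : S.card = s) (x : Fin m → ℝ) (hx : ∀ i ∉ S, x i = 0) :
    |QQ a x| ≤ (2 * μ) * ∑ l, x l ^ 2 := by
  set c0 : ℝ := (1 / n) * (∑ j, ∑ l, a j l ^ 2) + 1 with hc0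
  have hc00 : 0 ≤ c0 := by positivity
  have hinit : ∀ x : Fin m → ℝ, |QQ a x| ≤ c0 * ∑ l, x l ^ 2 := by
    intro x
    unfold QQ
    have hw : 0 ≤ ∑ l, x l ^ 2 := Finset.sum_nonneg fun l _ => sq_nonneg _
    have h1 : (1 / (n : ℝ)) * ∑ j, ff x (a j) ^ 2 ≤ (1 / (n : ℝ)) * ∑ j, (∑ l, x l ^ 2) * ∑ l, a j l ^ 2 := by
      gcongr with j
      exact Finset.sum_mul_sq_le_sq_mul_sq _ _ _
    rw [← Finset.mul_sum] at h1
    have h0 : 0 ≤ (1 / (n : ℝ)) * ∑ j, ff x (a j) ^ 2 := by positivity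
    have h2 : 0 ≤ (1 / (n : ℝ)) * (∑ j, ∑ l, a j l ^ 2) := by positivity
    rw [abs_le, hc0]
    constructor <;> nlinarith
  have hit : ∀ i : ℕ, ∀ x : Fin m → ℝ, (∀ i ∉ S, x i = 0) → |QQ a x| ≤ (2 * μ + (1 / 2) ^ i * c0) * ∑ l, x l ^ 2 := by
    intro i
    induction i with
    | zero =>
      intro x _
      refine (hinit x).trans ?_
      gcongr
      simp; exact hμ0
    | succ i ih =>
      intro x hx
      have := QQ_contr hs a μ _ (by positivity) hμ S hS ih x hx
      refine this.trans (le_of_eq ?_)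
      rw [pow_succ]; ring
  have hlim : Filter.Tendsto (fun i : ℕ => (2 * μ + (1 / 2) ^ i * c0) * ∑ l, x l ^ 2) Filter.atTop
      (nhds ((2 * μ + 0 * c0) * ∑ l, x l ^ 2)) := by
    refine Filter.Tendsto.mul_const _ (Filter.Tendsto.const_add _ (Filter.Tendsto.mul_const _ ?_))
    exact tendsto_pow_atTop_nhds_zero_of_lt_one (by norm_num) (by norm_num)
  have := ge_of_tendsto' hlim fun i => hit i x hx
  simpa using this

lemma RIP_of_net {n m s t : ℕ} (hn : 0 < n) (hs : 2 ≤ s) (hst : s = min t m) (a : Fin n → Fin m → ℝ) (δ : ℝ)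
    (hδ : 0 < δ) (hδ1 : δ < 1) (hμ : ∀ y ∈ netS m s, |QQ a y| ≤ δ / 2) :
    RIP (Matrix.of fun j k => (1 / Real.sqrt n) * a j k) t δ := by
  classical
  intro x hx
  unfold IsSparse at hx
  have hsup : (Finset.univ.filter fun i => x i ≠ 0).card ≤ s := by
    rw [hst, le_min_iff]
    constructor
    · rw [← Set.ncard_coe_finset]; simpa using hx
    · refine (Finset.card_le_univ _).trans (by simp)
  obtain ⟨S, hS1, hS2⟩ := Finset.exists_superset_card_eq hsup (by simp [hst])
  have hxS : ∀ i ∉ S, x i = 0 := by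
    intro i hi
    by_contra h
    exact hi (hS1 (by simp [h]))
  have hQ := QQ_net hs a (δ / 2) (by positivity) hμ S hS2 x hxS
  have e : ∑ j, ((Matrix.of fun j k => (1 / Real.sqrt n) * a j k).mulVec x) j ^ 2
      = (1 / n) * ∑ j, ff x (a j) ^ 2 := by
    rw [Finset.mul_sum]
    refine Finset.sum_congr rfl fun j _ => ?_
    have : ((Matrix.of fun j k => (1 / Real.sqrt n) * a j k).mulVec x) j = (1 / Real.sqrt n) * ff x (a j) := by
      simp only [Matrix.mulVec, dotProduct, Matrix.of_apply, ff, Finset.mul_sum]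
      exact Finset.sum_congr rfl fun l _ => by ring
    rw [this, mul_pow, div_pow, Real.sq_sqrt (by positivity), one_pow]
  unfold l2norm
  rw [e]
  unfold QQ at hQ
  set w := ∑ l, x l ^ 2 with hw
  have hw0 : 0 ≤ w := Finset.sum_nonneg fun l _ => sq_nonneg _
  set A := (1 / (n : ℝ)) * ∑ j, ff x (a j) ^ 2
  have hQ' := abs_le.1 hQ
  constructor
  · apply Real.le_sqrt_of_sq_le
    rw [mul_pow, Real.sq_sqrt hw0]
    have : (1 - δ) ^ 2 ≤ 1 - δ := by nlinarith
    nlinarith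
  · apply Real.sqrt_le_iff.2
    refine ⟨by positivity, ?_⟩
    rw [mul_pow, Real.sq_sqrt hw0]
    have : 1 + δ ≤ (1 + δ) ^ 2 := by nlinarith
    nlinarith


noncomputable def WW {n m : ℕ} (a b : Fin n → Fin m → ℝ) (y : Fin m → ℝ) : ℝ :=
  (1 / n) * ∑ j, (ff y (a j) ^ 2 + ff y (b j) ^ 2)

noncomputable def DD {n m : ℕ} (a b : Fin n → Fin m → ℝ) (x : Fin m → ℝ) : ℝ :=
  ∑ j, (ff x (a j) ^ 2 - ff x (b j) ^ 2)

def badp {n m : ℕ} (N : Finset (Fin m → ℝ)) (δ : ℝ) (a b : Fin n → Fin m → ℝ) : Prop :=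
  ∃ x ∈ N, ∀ y ∈ N, δ / 10 * n * √(max 1 (WW a b y)) < |DD a b x|

lemma ghost_det {n m : ℕ} (hn : 0 < n) (N : Finset (Fin m → ℝ)) (hN : ∀ x ∈ N, ∑ l, x l ^ 2 ≤ 1)
    (δ : ℝ) (hδ : 0 < δ) (hδ1 : δ < 1) (a : Fin n → Fin m → ℝ)
    (hB : ∃ x ∈ N, δ / 2 < |QQ a x|) :
    ∃ x ∈ N, ∀ b : Fin n → Fin m → ℝ, |QQ b x| < δ / 8 → badp N δ a b := by
  obtain ⟨x0, hx0, hx0'⟩ := hB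
  obtain ⟨x, hx, hxm⟩ := N.exists_max_image (fun x => |QQ a x|) ⟨x0, hx0⟩
  refine ⟨x, hx, fun b hb => ?_⟩
  have hD : δ / 2 < |QQ a x| := hx0'.trans_le (hxm x0 hx0)
  obtain ⟨y, hy, hym⟩ := N.exists_max_image (fun y => max 1 (WW a b y)) ⟨x0, hx0⟩
  by_contra hcon
  have hn' : (0 : ℝ) < n := by exact_mod_cast hn
  set M := max 1 (WW a b y) with hM
  have hall : ∀ z ∈ N, |DD a b z| ≤ δ / 10 * n * √M := by
    intro z hz
    by_contra h
    push Not at h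
    refine hcon ⟨z, hz, fun w hw => lt_of_le_of_lt ?_ h⟩
    gcongr
    exact hym w hw
  have hdiff : ∀ z, DD a b z = n * (QQ a z - QQ b z) := by
    intro z
    unfold DD QQ
    rw [Finset.sum_sub_distrib]
    field_simp
    ring
  have hall' : ∀ z ∈ N, |QQ a z - QQ b z| ≤ δ / 10 * √M := by
    intro z hz
    have := hall z hz
    rw [hdiff, abs_mul, abs_of_pos hn'] at this
    have h2 : n * |QQ a z - QQ b z| ≤ n * (δ / 10 * √M) := by linarith
    exact le_of_mul_le_mul_left h2 hn'
  set D := |QQ a x| with hDdef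
  have hM1 : 1 ≤ M := le_max_left _ _
  have hsq : √M ^ 2 = M := Real.sq_sqrt (by linarith)
  have hs0 : 0 ≤ √M := Real.sqrt_nonneg _
  have hW : WW a b y = QQ a y + QQ b y + 2 * ∑ l, y l ^ 2 := by
    unfold WW QQ
    rw [Finset.sum_add_distrib]; ring
  have hy1 := hN y hy
  have hyD : QQ a y ≤ D := (le_abs_self _).trans (hxm y hy)
  have hyb := abs_le.1 (hall' y hy)
  have hWle : WW a b y ≤ 2 + 2 * D + δ / 10 * √M := by
    rw [hW]; linarith [hyb.1]
  have hsm : √M ≤ (M + 1) / 2 := by nlinarith [sq_nonneg (√M - 1)]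
  have hds : δ / 10 * √M ≤ 1 / 20 * (M + 1) := by nlinarith
  have hMle : M ≤ 22 / 10 + 22 / 10 * D := by
    have : M ≤ 2 + 2 * D + 1 / 20 * (M + 1) := by
      rw [hM] at *
      refine max_le ?_ ?_ <;> linarith
    linarith
  have hxb := hall' x hx
  have h3 : 3 / 4 * D ≤ δ / 10 * √M := by
    have := abs_sub_abs_le_abs_sub (QQ a x) (QQ b x)
    linarith
  have hD0 : 0 < D := by linarith
  have h4 : (3 / 4 * D) ^ 2 ≤ (δ / 10 * √M) ^ 2 := by gcongr
  rw [mul_pow (δ / 10), hsq] at h4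
  have h5 : (δ / 10) ^ 2 * M ≤ (δ / 10) ^ 2 * (22 / 10 + 22 / 10 * D) := by gcongr
  have h6 : δ ^ 2 ≤ 4 * D ^ 2 := by nlinarith
  have h7 : δ ^ 2 * D ≤ 2 * D ^ 2 := by nlinarith
  nlinarith

lemma measurable_ff {Ω : Type*} [MeasurableSpace Ω] {m : ℕ} (x : Fin m → ℝ) (φ : Ω → Fin m → ℝ)
    (hφ : Measurable φ) : Measurable fun ω => ff x (φ ω) := by
  unfold ff
  fun_prop

lemma measurableSet_badp {Ω : Type*} [MeasurableSpace Ω] {n m : ℕ} (N : Finset (Fin m → ℝ)) (δ : ℝ)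
    (a b : Ω → Fin n → Fin m → ℝ) (ha : Measurable a) (hb : Measurable b) :
    MeasurableSet {ω | badp N δ (a ω) (b ω)} := by
  have hA : ∀ (x : Fin m → ℝ) j, Measurable fun ω => ff x (a ω j) := fun x j =>
    measurable_ff x _ (by fun_prop)
  have hB : ∀ (x : Fin m → ℝ) j, Measurable fun ω => ff x (b ω j) := fun x j =>
    measurable_ff x _ (by fun_prop)
  have e : {ω | badp N δ (a ω) (b ω)} = ⋃ x ∈ N, ⋂ y ∈ N,
      {ω | δ / 10 * n * √(max 1 (WW (a ω) (b ω) y)) < |DD (a ω) (b ω) x|} := by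
    ext ω; simp [badp]
  rw [e]
  refine Finset.measurableSet_biUnion _ fun x _ => Finset.measurableSet_biInter _ fun y _ => ?_
  refine measurableSet_lt ?_ ?_
  · unfold WW
    fun_prop
  · unfold DD
    refine Measurable.abs ?_
    fun_prop

lemma measurableSet_B {Ω : Type*} [MeasurableSpace Ω] {n m : ℕ} (N : Finset (Fin m → ℝ)) (c : ℝ)
    (a : Ω → Fin n → Fin m → ℝ) (ha : Measurable a) :
    MeasurableSet {ω | ∃ x ∈ N, c < |QQ (a ω) x|} := by
  have hA : ∀ (x : Fin m → ℝ) j, Measurable fun ω => ff x (a ω j) := fun x j =>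
    measurable_ff x _ (by fun_prop)
  have e : {ω | ∃ x ∈ N, c < |QQ (a ω) x|} = ⋃ x ∈ N, {ω | c < |QQ (a ω) x|} := by
    ext ω; simp
  rw [e]
  refine Finset.measurableSet_biUnion _ fun x _ => measurableSet_lt measurable_const ?_
  unfold QQ
  refine Measurable.abs ?_
  fun_prop

open Classical in
lemma core_bad {n m s : ℕ} (hm : 2 ≤ m) (hs : 2 ≤ s) (hsm : s ≤ m) (K δ lam : ℝ) (hK : 1 ≤ K) (hδ : 0 < δ)
    (hn0 : 0 < n)
    (hlam : Real.log s ^ 3 ≤ lam) (hn : 2000000000 / δ ^ 2 * K ^ 2 * s * lam * Real.log m ≤ n)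
    (a b : Fin n → Fin m → ℝ) (ha : ∀ j l, |a j l| ≤ K) (hb : ∀ j l, |b j l| ≤ K) :
    ((Finset.univ.filter (fun ε : Fin n → Bool => badp (netS m s) δ
      (fun j => if ε j then a j else b j) (fun j => if ε j then b j else a j))).card : ℝ)
      ≤ 2 ^ n * ((m : ℝ) ^ (-lam) / 2) := by
  have hn' : (0 : ℝ) < n := by exact_mod_cast hn0
  have hne : (netS m s).Nonempty := ⟨_, netS_single (by omega) hsm ⟨0, by omega⟩⟩
  obtain ⟨y, hy, hym⟩ := (netS m s).exists_max_image (fun y => max 1 (WW a b y)) hne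
  set M := max 1 (WW a b y) with hM
  have hM1 : 1 ≤ M := le_max_left _ _
  have hWM : ∀ x ∈ netS m s, ∑ j, (ff x (a j) ^ 2 + ff x (b j) ^ 2) ≤ n * M := by
    intro x hx
    have h1 : WW a b x ≤ M := (le_max_right _ _).trans (hym x hx)
    unfold WW at h1
    rw [one_div, inv_mul_le_iff₀ hn'] at h1
    exact h1
  have hc := core hm hs hsm K δ lam M hK hδ hlam hn hM1 a b ha hb (netS m s)
    (fun x hx => netS_l1 x hx) (netS_card hm hsm) hWM (by
      intro l
      have := hWM _ (netS_single (by omega) hsm l)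
      simpa [ff, Pi.single_apply] using this)
  refine le_trans ?_ hc
  norm_cast
  refine Finset.card_le_card ?_
  intro ε hε
  simp only [Finset.mem_filter, Finset.mem_univ, true_and] at hε ⊢
  obtain ⟨x, hx, h⟩ := hε
  refine ⟨x, hx, ?_⟩
  have h1 := h y hy
  have eW : WW (fun j => if ε j then a j else b j) (fun j => if ε j then b j else a j) y = WW a b y := by
    unfold WW
    congr 1
    refine Finset.sum_congr rfl fun j _ => ?_
    cases hj : ε j <;> simp [hj, add_comm]
  have eD : DD (fun j => if ε j then a j else b j) (fun j => if ε j then b j else a j) x = GG a b ε x := by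
    unfold DD GG
    refine Finset.sum_congr rfl fun j _ => ?_
    cases hj : ε j <;> simp [sg, hj]
  rw [eW, eD] at h1
  exact h1


def sigz {Ω : Type*} {n : ℕ} (ε : Fin n → Bool) (z : Fin n → Ω × Ω) : Fin n → Ω × Ω :=
  fun j => (if ε j then id else Prod.swap) (z j)

lemma sigz_mp {Ω : Type*} [MeasurableSpace Ω] {n : ℕ} (ν : Measure Ω) [IsProbabilityMeasure ν]
    (ε : Fin n → Bool) :
    MeasurePreserving (sigz ε) (Measure.pi fun _ : Fin n => ν.prod ν) (Measure.pi fun _ : Fin n => ν.prod ν) := by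
  refine measurePreserving_pi (fun _ : Fin n => ν.prod ν) (fun _ : Fin n => ν.prod ν)
    (f := fun j => if ε j then id else Prod.swap) fun j => ?_
  cases hj : ε j
  · simpa [hj] using Measure.measurePreserving_swap
  · simpa [hj] using MeasurePreserving.id _

open Classical in
lemma ghost_prob {Ω : Type*} [MeasurableSpace Ω] (ν : Measure Ω) [IsProbabilityMeasure ν]
    {n m s : ℕ} (hm : 2 ≤ m) (hs : 2 ≤ s) (hsm : s ≤ m) (K δ lam : ℝ) (hK : 1 ≤ K) (hδ : 0 < δ)
    (hn0 : 0 < n)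
    (hlam : Real.log s ^ 3 ≤ lam) (hn : 2000000000 / δ ^ 2 * K ^ 2 * s * lam * Real.log m ≤ n)
    (φ : Ω → Fin m → ℝ) (hφ : Measurable φ) (hb : ∀ ω l, |φ ω l| ≤ K) :
    ((Measure.pi (fun _ : Fin n => ν)).prod (Measure.pi (fun _ : Fin n => ν)))
      {p | badp (netS m s) δ (fun j => φ (p.1 j)) (fun j => φ (p.2 j))}
      ≤ ENNReal.ofReal ((m : ℝ) ^ (-lam) / 2) := by
  have hmp := measurePreserving_arrowProdEquivProdArrow Ω Ω (Fin n) (fun _ => ν) (fun _ => ν)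
  set G : Set ((Fin n → Ω) × (Fin n → Ω)) :=
    {p | badp (netS m s) δ (fun j => φ (p.1 j)) (fun j => φ (p.2 j))} with hG
  have hGm : MeasurableSet G := by
    refine measurableSet_badp _ _ _ _ ?_ ?_ <;> fun_prop
  rw [← hmp.measure_preimage hGm.nullMeasurableSet]
  set G' := (MeasurableEquiv.arrowProdEquivProdArrow Ω Ω (Fin n)) ⁻¹' G with hG'
  have hGm' : MeasurableSet G' := hmp.measurable hGm
  set μ := Measure.pi fun _ : Fin n => ν.prod ν with hμ
  have key : (2 : ENNReal) ^ n * μ G' ≤ 2 ^ n * ENNReal.ofReal ((m : ℝ) ^ (-lam) / 2) := by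
    calc (2 : ENNReal) ^ n * μ G' = ∑ ε : Fin n → Bool, μ (sigz ε ⁻¹' G') := by
          rw [Finset.sum_congr rfl fun ε _ => (sigz_mp ν ε).measure_preimage hGm'.nullMeasurableSet]
          simp [hμ]
      _ = ∑ ε : Fin n → Bool, ∫⁻ z, (sigz ε ⁻¹' G').indicator 1 z ∂μ := by
          refine Finset.sum_congr rfl fun ε _ => ?_
          rw [lintegral_indicator_one ((sigz_mp ν ε).measurable hGm')]
      _ = ∫⁻ z, ∑ ε : Fin n → Bool, (sigz ε ⁻¹' G').indicator 1 z ∂μ := by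
          rw [lintegral_finsetSum]
          intro ε _
          exact measurable_one.indicator ((sigz_mp ν ε).measurable hGm')
      _ ≤ ∫⁻ z, 2 ^ n * ENNReal.ofReal ((m : ℝ) ^ (-lam) / 2) ∂μ := by
          refine lintegral_mono fun z => ?_
          have hc := core_bad hm hs hsm K δ lam hK hδ hn0 hlam hn (fun j => φ (z j).1) (fun j => φ (z j).2)
            (fun j l => hb _ l) (fun j l => hb _ l)
          have e : ∑ ε : Fin n → Bool, (sigz ε ⁻¹' G').indicator (1 : (Fin n → Ω × Ω) → ENNReal) z
              = ENNReal.ofReal ((Finset.univ.filter (fun ε : Fin n → Bool => badp (netS m s) δ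
                (fun j => if ε j then φ (z j).1 else φ (z j).2) (fun j => if ε j then φ (z j).2 else φ (z j).1))).card : ℝ) := by
            rw [ENNReal.ofReal_natCast, Finset.card_filter]
            push_cast
            refine Finset.sum_congr rfl fun ε _ => ?_
            rw [Set.indicator_apply]
            have : z ∈ sigz ε ⁻¹' G' ↔ badp (netS m s) δ
                (fun j => if ε j then φ (z j).1 else φ (z j).2) (fun j => if ε j then φ (z j).2 else φ (z j).1) := by
              have h1 : (fun j => φ (sigz ε z j).1) = fun j => if ε j then φ (z j).1 else φ (z j).2 := by
                funext j; unfold sigz; cases hj : ε j <;> simp [hj]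
              have h2 : (fun j => φ (sigz ε z j).2) = fun j => if ε j then φ (z j).2 else φ (z j).1 := by
                funext j; unfold sigz; cases hj : ε j <;> simp [hj]
              rw [← h1, ← h2]
              rfl
            simp only [this, Pi.one_apply]
          rw [e]
          refine (ENNReal.ofReal_le_ofReal hc).trans (le_of_eq ?_)
          rw [ENNReal.ofReal_mul (by positivity), ENNReal.ofReal_pow (by norm_num)]
          simp
      _ = _ := by simp
  rwa [ENNReal.mul_le_mul_iff_right (by simp) (by simp)] at key

lemma cheb {Ω : Type*} [MeasurableSpace Ω] (ν : Measure Ω) [IsProbabilityMeasure ν]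
    {n m s : ℕ} (K δ : ℝ) (hK : 1 ≤ K) (hδ : 0 < δ)
    (hn0 : 0 < n) (hn : 128 * (K ^ 2 * s) ≤ n * δ ^ 2)
    (φ : Ω → Fin m → ℝ) (hφ : Measurable φ) (hb : ∀ ω l, |φ ω l| ≤ K)
    (ho : ∀ j k, ∫ ω, φ ω j * φ ω k ∂ν = if j = k then 1 else 0)
    (x : Fin m → ℝ) (hx1 : ∑ l, |x l| ≤ √s) (hx2 : ∑ l, x l ^ 2 ≤ 1) :
    Measure.pi (fun _ : Fin n => ν) {X | δ / 8 ≤ |QQ (fun j => φ (X j)) x|} ≤ 1 / 2 := by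
  have hn' : (0 : ℝ) < n := by exact_mod_cast hn0
  set g : Ω → ℝ := fun ω => ff x (φ ω) ^ 2 with hg
  have hgm : Measurable g := (measurable_ff x φ hφ).pow_const 2
  have hgb : ∀ ω, |g ω| ≤ K ^ 2 * s := by
    intro ω
    have := ff_bd x (φ ω) K (√s) (by linarith) (hb ω) hx1
    have h2 : |ff x (φ ω)| ^ 2 ≤ (K * √s) ^ 2 := by gcongr
    rw [mul_pow, Real.sq_sqrt (by positivity), sq_abs] at h2
    rw [hg, abs_of_nonneg (by positivity)]
    exact h2
  have hint : ∀ j k, Integrable (fun ω => φ ω j * φ ω k) ν := by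
    intro j k
    refine Integrable.of_bound (C := K * K) (by fun_prop) (Filter.Eventually.of_forall fun ω => ?_)
    rw [Real.norm_eq_abs, abs_mul]
    have := hb ω j; have := hb ω k
    gcongr
  have hEg : ∫ ω, g ω ∂ν = ∑ l, x l ^ 2 := by
    have e : g = fun ω => ∑ j, ∑ k, x j * x k * (φ ω j * φ ω k) := by
      funext ω
      simp only [hg, ff, sq, Finset.sum_mul_sum]
      refine Finset.sum_congr rfl fun j _ => Finset.sum_congr rfl fun k _ => by ring
    rw [e, integral_finsetSum _ fun j _ => integrable_finsetSum _ fun k _ => (hint j k).const_mul _]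
    refine Finset.sum_congr rfl fun j _ => ?_
    rw [integral_finsetSum _ fun k _ => (hint j k).const_mul _]
    simp_rw [integral_const_mul, ho]
    simp [sq]
  have hgL : MemLp g 2 ν := MemLp.of_bound hgm.aestronglyMeasurable (K ^ 2 * s)
    (Filter.Eventually.of_forall hgb)
  have hgi : Integrable g ν := hgL.integrable (by norm_num)
  have hvar : ProbabilityTheory.variance g ν ≤ K ^ 2 * s := by
    refine (ProbabilityTheory.variance_le_expectation_sq hgm.aestronglyMeasurable).trans ?_
    calc ∫ ω, (g ^ 2) ω ∂ν ≤ ∫ ω, K ^ 2 * s * g ω ∂ν := by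
          refine integral_mono hgL.integrable_sq (hgi.const_mul _) fun ω => ?_
          have h1 := (abs_le.1 (hgb ω)).2
          have h0 : 0 ≤ g ω := sq_nonneg _
          simp only [Pi.pow_apply]
          nlinarith
      _ = K ^ 2 * s * ∑ l, x l ^ 2 := by rw [integral_const_mul, hEg]
      _ ≤ K ^ 2 * s * 1 := by gcongr
      _ = _ := by ring
  set P := Measure.pi (fun _ : Fin n => ν) with hP
  have hmpe : ∀ j, MeasurePreserving (fun X : Fin n → Ω => X j) P ν := fun j =>
    measurePreserving_eval (fun _ : Fin n => ν) j
  have hXL : ∀ j : Fin n, MemLp (fun X : Fin n → Ω => g (X j)) 2 P := fun j =>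
    hgL.comp_measurePreserving (hmpe j)
  have hind : ProbabilityTheory.iIndepFun (fun (j : Fin n) (X : Fin n → Ω) => g (X j)) P :=
    ProbabilityTheory.iIndepFun_pi (X := fun (_ : Fin n) => g) (fun j => hgm.aemeasurable)
  set T : (Fin n → Ω) → ℝ := ∑ j, fun X : Fin n → Ω => g (X j) with hT
  have hTL : MemLp T 2 P := memLp_finsetSum' _ fun j _ => hXL j
  have hTvar : ProbabilityTheory.variance T P ≤ n * (K ^ 2 * s) := by
    rw [hT, ProbabilityTheory.IndepFun.variance_sum (fun j _ => hXL j)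
      (fun i _ j _ hij => hind.indepFun hij)]
    calc ∑ j : Fin n, ProbabilityTheory.variance (fun X : Fin n → Ω => g (X j)) P
        ≤ ∑ j : Fin n, K ^ 2 * s := by
          refine Finset.sum_le_sum fun j _ => ?_
          have := (hmpe j).variance_fun_comp (f := g) hgm.aemeasurable
          rw [this]; exact hvar
      _ = _ := by simp
  have hTE : ∫ X, T X ∂P = n * ∑ l, x l ^ 2 := by
    simp only [hT, Finset.sum_apply]
    rw [integral_finsetSum _ fun j _ => (hXL j).integrable (by norm_num)]
    have : ∀ j : Fin n, ∫ X, g (X j) ∂P = ∑ l, x l ^ 2 := by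
      intro j
      rw [← hEg, ← (hmpe j).map_eq, integral_map (hmpe j).measurable.aemeasurable
        hgm.aestronglyMeasurable]
    simp [this]
  have hc := ProbabilityTheory.meas_ge_le_variance_div_sq hTL (c := n * (δ / 8)) (by positivity)
  have hset : {X : Fin n → Ω | δ / 8 ≤ |QQ (fun j => φ (X j)) x|}
      = {X | n * (δ / 8) ≤ |T X - ∫ X, T X ∂P|} := by
    ext X
    simp only [Set.mem_ofPred_eq]
    rw [hTE]
    have : T X - n * ∑ l, x l ^ 2 = n * QQ (fun j => φ (X j)) x := by
      simp only [hT, Finset.sum_apply, hg, QQ]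
      field_simp
    rw [this, abs_mul, abs_of_pos hn', mul_le_mul_iff_right₀ hn']
  rw [hset]
  refine hc.trans ?_
  have : ProbabilityTheory.variance T P / (n * (δ / 8)) ^ 2 ≤ 1 / 2 := by
    rw [div_le_iff₀ (by positivity)]
    refine hTvar.trans ?_
    have : (n : ℝ) * (128 * (K ^ 2 * s)) ≤ n * (n * δ ^ 2) := by gcongr
    nlinarith
  refine (ENNReal.ofReal_le_ofReal this).trans (le_of_eq ?_)
  rw [ENNReal.ofReal_div_of_pos (by norm_num)]; simp


lemma B_prob {Ω : Type*} [MeasurableSpace Ω] (ν : Measure Ω) [IsProbabilityMeasure ν]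
    {n m s : ℕ} (hm : 2 ≤ m) (hs : 2 ≤ s) (hsm : s ≤ m) (K δ lam : ℝ) (hK : 1 ≤ K) (hδ : 0 < δ)
    (hδ1 : δ < 1) (hn0 : 0 < n) (hn2 : 128 * (K ^ 2 * s) ≤ n * δ ^ 2)
    (hlam : Real.log s ^ 3 ≤ lam) (hn : 2000000000 / δ ^ 2 * K ^ 2 * s * lam * Real.log m ≤ n)
    (φ : Ω → Fin m → ℝ) (hφ : Measurable φ) (hb : ∀ ω l, |φ ω l| ≤ K)
    (ho : ∀ j k, ∫ ω, φ ω j * φ ω k ∂ν = if j = k then 1 else 0) :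
    Measure.pi (fun _ : Fin n => ν) {X | ∃ x ∈ netS m s, δ / 2 < |QQ (fun j => φ (X j)) x|}
      ≤ ENNReal.ofReal ((m : ℝ) ^ (-lam)) := by
  have hg := ghost_prob ν hm hs hsm K δ lam hK hδ hn0 hlam hn φ hφ hb
  set P := Measure.pi (fun _ : Fin n => ν) with hP
  set G : Set ((Fin n → Ω) × (Fin n → Ω)) :=
    {p | badp (netS m s) δ (fun j => φ (p.1 j)) (fun j => φ (p.2 j))} with hG
  have hGm : MeasurableSet G := by
    refine measurableSet_badp _ _ _ _ ?_ ?_ <;> fun_prop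
  set B : Set (Fin n → Ω) := {X | ∃ x ∈ netS m s, δ / 2 < |QQ (fun j => φ (X j)) x|} with hBdef
  have hBm : MeasurableSet B := measurableSet_B _ _ _ (by fun_prop)
  have h1 : (1 / 2 : ENNReal) * P B ≤ (P.prod P) G := by
    rw [Measure.prod_apply hGm]
    calc (1 / 2 : ENNReal) * P B = ∫⁻ X in B, (1 / 2 : ENNReal) ∂P := by
          rw [setLIntegral_const]
      _ ≤ ∫⁻ X in B, P (Prod.mk X ⁻¹' G) ∂P := by
          refine setLIntegral_mono' hBm fun X hX => ?_
          obtain ⟨x, hx, hxb⟩ := ghost_det hn0 (netS m s) (fun x hx => ((mem_netS x).1 hx).2) δ hδ hδ1 _ hX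
          have hc := cheb ν K δ hK hδ hn0 hn2 φ hφ hb ho x (netS_l1 x hx) ((mem_netS x).1 hx).2
          have hcover : (Set.univ : Set (Fin n → Ω)) ⊆
              (Prod.mk X ⁻¹' G) ∪ {X | δ / 8 ≤ |QQ (fun j => φ (X j)) x|} := by
            intro Y _
            by_cases hY : δ / 8 ≤ |QQ (fun j => φ (Y j)) x|
            · exact Or.inr hY
            · exact Or.inl (hxb _ (not_le.1 hY))
          have h2 : (1 : ENNReal) ≤ P (Prod.mk X ⁻¹' G) + 1 / 2 := by
            calc (1 : ENNReal) = P Set.univ := by simp [hP]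
              _ ≤ _ := (measure_mono hcover).trans (measure_union_le _ _)
              _ ≤ _ := by gcongr
          have h3 : (1 / 2 : ENNReal) + 1 / 2 ≤ P (Prod.mk X ⁻¹' G) + 1 / 2 := by
            rw [ENNReal.add_halves]; exact h2
          exact (ENNReal.add_le_add_iff_right (by simp)).1 h3
      _ ≤ _ := setLIntegral_le_lintegral _ _
  have h2 := h1.trans hg
  rw [ENNReal.ofReal_div_of_pos (by norm_num), one_div, ENNReal.div_eq_inv_mul, ENNReal.ofReal_ofNat,
    ENNReal.mul_le_mul_iff_right (by simp) (by simp)] at h2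
  exact h2

theorem RIP_main (d m : ℕ) (D : Set (Fin d → ℝ)) (hD : MeasurableSet D)
    (ν : Measure (Fin d → ℝ)) [IsProbabilityMeasure ν] (hν : ν Dᶜ = 0)
    (ψ : Fin m → (Fin d → ℝ) → ℝ) (K : ℝ) (hK : 1 ≤ K)
    (hψ : ∀ k, Measurable (ψ k))
    (ho : ∀ j k, ∫ x, ψ j x * ψ k x ∂ν = if j = k then 1 else 0)
    (hb : ∀ k, ∀ x ∈ D, |ψ k x| ≤ K)
    (δ : ℝ) (t n : ℕ) (hδ : 0 < δ) (hδ1 : δ < 1) (ht : 2 ≤ t) (hm : 2 ≤ m)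
    (hn : (2000000000 / δ ^ 2) * K ^ 2 * t * (Real.log t) ^ 3 * Real.log m ≤ n) :
    ENNReal.ofReal (1 - (m : ℝ) ^ (-((Real.log t) ^ 3))) ≤
      Measure.pi (fun _ : Fin n => ν)
        {xs : Fin n → (Fin d → ℝ) |
          RIP (Matrix.of fun j k => (1 / Real.sqrt n) * ψ k (xs j)) t δ} := by
  set s := min t m with hs
  have hs2 : 2 ≤ s := le_min ht hm
  have hst : (s : ℝ) ≤ t := by exact_mod_cast min_le_left t m
  have hs2' : (2 : ℝ) ≤ s := by exact_mod_cast hs2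
  have hlogt : Real.log 2 ≤ Real.log t := Real.log_le_log (by norm_num) (by exact_mod_cast ht)
  have hlogm : Real.log 2 ≤ Real.log m := Real.log_le_log (by norm_num) (by exact_mod_cast hm)
  have hl2 : (1 / 2 : ℝ) ≤ Real.log 2 := by linarith [Real.log_two_gt_d9]
  have hlam : Real.log s ^ 3 ≤ Real.log t ^ 3 := by
    have : 0 ≤ Real.log s := Real.log_nonneg (by linarith)
    gcongr
  have hlt3 : (1 / 8 : ℝ) ≤ Real.log t ^ 3 := by
    calc (1 / 8 : ℝ) = (1 / 2) ^ 3 := by norm_num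
      _ ≤ _ := by gcongr; linarith
  have hns : 2000000000 / δ ^ 2 * K ^ 2 * s * Real.log t ^ 3 * Real.log m ≤ n := by
    refine le_trans ?_ hn
    have : 0 ≤ Real.log m := by linarith
    gcongr
  have hn16 : 2000000000 / δ ^ 2 * K ^ 2 * s * (1 / 8) * (1 / 2) ≤ n := by
    refine le_trans ?_ hns
    gcongr; linarith
  have hn0 : 0 < n := by
    have : (0 : ℝ) < n := lt_of_lt_of_le (by positivity) hn16
    exact_mod_cast this
  have hn2 : 128 * (K ^ 2 * s) ≤ n * δ ^ 2 := by
    have h1 : 2000000000 / δ ^ 2 * K ^ 2 * s * (1 / 8) * (1 / 2) * δ ^ 2 ≤ n * δ ^ 2 := by gcongr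
    have h2 : 2000000000 / δ ^ 2 * K ^ 2 * s * (1 / 8) * (1 / 2) * δ ^ 2 = 125000000 * (K ^ 2 * s) := by
      field_simp; norm_num
    have : 0 ≤ K ^ 2 * (s : ℝ) := by positivity
    linarith
  set φ : (Fin d → ℝ) → Fin m → ℝ := fun x k => D.indicator (ψ k) x with hφdef
  have hφ : Measurable φ := measurable_pi_lambda _ fun k => (hψ k).indicator hD
  have hφb : ∀ ω l, |φ ω l| ≤ K := by
    intro ω l
    simp only [hφdef]
    by_cases h : ω ∈ D
    · rw [Set.indicator_of_mem h]; exact hb l ω h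
    · rw [Set.indicator_of_notMem h]; simp; linarith
  have hae : ∀ᵐ x ∂ν, x ∈ D := by
    rw [ae_iff]; exact hν
  have hφo : ∀ j k, ∫ ω, φ ω j * φ ω k ∂ν = if j = k then 1 else 0 := by
    intro j k
    rw [← ho j k]
    refine integral_congr_ae ?_
    filter_upwards [hae] with x hx
    simp [hφdef, hx]
  have hB := B_prob ν hm hs2 (min_le_right t m) K δ _ hK hδ hδ1 hn0 hn2 hlam hns φ hφ hφb hφo
  set P := Measure.pi (fun _ : Fin n => ν) with hP
  set S := {xs : Fin n → (Fin d → ℝ) |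
          RIP (Matrix.of fun j k => (1 / Real.sqrt n) * ψ k (xs j)) t δ} with hS
  have hnull : P {X | ∀ j, X j ∈ D}ᶜ = 0 := by
    rw [← mem_ae_iff]
    have : ∀ j : Fin n, ∀ᵐ X ∂P, X j ∈ D := fun j =>
      (measurePreserving_eval (fun _ : Fin n => ν) j).quasiMeasurePreserving.ae hae
    exact ae_all_iff.2 this
  have hcover : (Set.univ : Set (Fin n → Fin d → ℝ)) ⊆
      (S ∪ {X | ∃ x ∈ netS m s, δ / 2 < |QQ (fun j => φ (X j)) x|}) ∪ {X | ∀ j, X j ∈ D}ᶜ := by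
    intro X _
    by_cases hX : ∀ j, X j ∈ D
    · left
      by_cases hXB : ∃ x ∈ netS m s, δ / 2 < |QQ (fun j => φ (X j)) x|
      · exact Or.inr hXB
      · left
        push Not at hXB
        have := RIP_of_net hn0 hs2 hs (fun j => φ (X j)) δ hδ hδ1 hXB
        have e : (fun (j : Fin n) (k : Fin m) => (1 / Real.sqrt n) * φ (X j) k)
            = fun (j : Fin n) (k : Fin m) => (1 / Real.sqrt n) * ψ k (X j) := by
          funext j k
          simp [hφdef, hX j]
        rw [e] at this
        exact this
    · exact Or.inr hX
  have h1 : (1 : ENNReal) ≤ P S + ENNReal.ofReal ((m : ℝ) ^ (-(Real.log t) ^ 3)) := by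
    calc (1 : ENNReal) = P Set.univ := by simp [hP]
      _ ≤ _ := measure_mono hcover
      _ ≤ _ := measure_union_le _ _
      _ ≤ _ := add_le_add (measure_union_le _ _) hnull.le
      _ ≤ _ := by rw [add_zero]; gcongr
  rw [ENNReal.ofReal_sub _ (by positivity), ENNReal.ofReal_one]
  exact tsub_le_iff_right.2 h1

theorem RIP_boundedOrthonormalSystem :
    ∃ C γ : ℝ, 0 < C ∧ 0 < γ ∧
      ∀ (d m : ℕ) (D : Set (Fin d → ℝ)) (_ : MeasurableSet D)
        (ν : Measure (Fin d → ℝ)) (_ : IsProbabilityMeasure ν), ν Dᶜ = 0 →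
      ∀ (ψ : Fin m → (Fin d → ℝ) → ℝ) (K : ℝ), 1 ≤ K →
        (∀ k, Measurable (ψ k)) →
        (∀ j k, ∫ x, ψ j x * ψ k x ∂ν = if j = k then 1 else 0) →
        (∀ k, ∀ x ∈ D, |ψ k x| ≤ K) →
      ∀ (δ : ℝ) (s n : ℕ), δ ∈ Set.Ioo (0 : ℝ) 1 → 2 ≤ s →
        (C / δ ^ 2) * K ^ 2 * s * (Real.log s) ^ 3 * Real.log m ≤ n →
        ENNReal.ofReal (1 - (m : ℝ) ^ (-(γ * (Real.log s) ^ 3))) ≤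
          Measure.pi (fun _ : Fin n => ν)
            {xs : Fin n → (Fin d → ℝ) |
              RIP (Matrix.of fun j k => (1 / Real.sqrt n) * ψ k (xs j)) s δ} := by
  refine ⟨2000000000, 1, by norm_num, by norm_num, ?_⟩
  intro d m D hD ν hprob hν ψ K hK hψ ho hb δ s n hδ hs hn
  rcases Nat.lt_or_ge m 2 with hm | hm
  · interval_cases m
    · have : {xs : Fin n → (Fin d → ℝ) |
              RIP (Matrix.of fun j (k : Fin 0) => (1 / Real.sqrt n) * ψ k (xs j)) s δ} = Set.univ := by
        ext xs
        simp [RIP, l2norm]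
      rw [this, measure_univ]
      rw [← ENNReal.ofReal_one]
      refine ENNReal.ofReal_le_ofReal ?_
      have : (0 : ℝ) ≤ ((0 : ℕ) : ℝ) ^ (-(1 * Real.log s ^ 3)) := by positivity
      linarith
    · simp
  · rw [one_mul]
    exact RIP_main d m D hD ν hν ψ K hK hψ ho hb δ s n hδ.1 hδ.2 hs hm hn
end

section
/- Let a < b with b finite, let w : [a,b] → ℝ be a nonnegative, non-decreasing weight function with ∫_a^b w(x) dx > 0, and let p be a polynomial of degree k that is orthonormal with respect to w, i.e., ∫_a^b p(x) q(x) w(x) dx = 0 for every polynomial q of degree < k and ∫_a^b p(x)² w(x) dx = 1. Then the function x ↦ w(x)·p(x)² attains its maximum over [a,b] at x = b; that is, w(x)·p(x)² ≤ w(b)·p(b)² for all x ∈ [a,b]. -/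
open Polynomial in
lemma sz_fac (T : Finset ℕ) (ζ : ℕ → ℝ) (hinj : Set.InjOn ζ T) (s : Polynomial ℝ)
    (hd : s.natDegree ≤ T.card) (hz : ∀ i ∈ T, s.eval (ζ i) = 0) :
    ∃ c : ℝ, ∀ x, s.eval x = c * ∏ i ∈ T, (x - ζ i) := by
  classical
  have hdvd : (∏ i ∈ T, (X - C (ζ i))) ∣ s := by
    apply Finset.prod_dvd_of_coprime
    · intro i hi j hj hij
      exact isCoprime_X_sub_C_of_isUnit_sub
        (sub_ne_zero.2 (fun h => hij (hinj hi hj h))).isUnit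
    · intro i hi
      exact dvd_iff_isRoot.2 (hz i hi)
  obtain ⟨t, ht⟩ := hdvd
  have hmon : (∏ i ∈ T, (X - C (ζ i))).Monic := monic_prod_of_monic _ _ (fun i _ => monic_X_sub_C _)
  have hdeg : (∏ i ∈ T, (X - C (ζ i))).natDegree = T.card := by simp
  by_cases h0 : t = 0
  · refine ⟨0, fun x => ?_⟩
    simp [ht, h0]
  have h1 : s.natDegree = T.card + t.natDegree := by
    rw [ht, hmon.natDegree_mul' h0, hdeg]
  have h2 : t.natDegree = 0 := by omega
  obtain ⟨c, hc⟩ := natDegree_eq_zero.1 h2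
  refine ⟨c, fun x => ?_⟩
  rw [ht, ← hc, eval_mul, eval_C, eval_prod, mul_comm]
  simp

lemma sz_zero (p s : Polynomial ℝ) (u v : ℝ) (huv : u < v)
    (hp : ∀ x, u < x → x < v → p.eval x ≠ 0)
    (hi : ∫ x in u..v, p.eval x * s.eval x = 0) : ∃ z, u < z ∧ z < v ∧ s.eval z = 0 := by
  have hc : Continuous (fun x => p.eval x * s.eval x) := by fun_prop
  have hd : ∀ t, HasDerivAt (fun t => ∫ x in u..t, p.eval x * s.eval x) (p.eval t * s.eval t) t :=
    fun t => hc.integral_hasStrictDerivAt u t |>.hasDerivAt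
  obtain ⟨z, hz, h⟩ := exists_hasDerivAt_eq_zero huv
    (fun t _ => (hd t).continuousAt.continuousWithinAt) (by simp [hi]) (fun t _ => hd t)
  exact ⟨z, hz.1, hz.2, (mul_eq_zero.1 h).resolve_left (hp z hz.1 hz.2)⟩

open Polynomial in
lemma sz_exists (k : ℕ) (p : Polynomial ℝ) (y : ℕ → ℝ)
    (hy : ∀ i j, i < j → j ≤ k → y i < y j)
    (hp : ∀ i < k, ∀ x, y i < x → x < y (i+1) → p.eval x ≠ 0) (f : ℕ → ℝ) :
    ∃ q : Polynomial ℝ, q.degree < k ∧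
      ∀ i < k, ∫ x in (y i)..(y (i+1)), p.eval x * q.eval x = f i := by
  let L : degreeLT ℝ k →ₗ[ℝ] (Fin k → ℝ) :=
    { toFun := fun q i => ∫ x in (y i)..(y (i+1)), p.eval x * (q : ℝ[X]).eval x
      map_add' := by
        intro q r
        ext i
        simp only [Submodule.coe_add, eval_add, Pi.add_apply, mul_add]
        rw [intervalIntegral.integral_add] <;>
          exact Continuous.intervalIntegrable (by fun_prop) _ _
      map_smul' := by
        intro c q
        ext i
        simp only [Submodule.coe_smul, eval_smul, smul_eq_mul, RingHom.id_apply, Pi.smul_apply]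
        rw [← intervalIntegral.integral_const_mul]
        congr 1
        ext x
        ring }
  have hinj : Function.Injective L := by
    rw [injective_iff_map_eq_zero]
    intro q hq
    have h1 : ∀ i : Fin k, ∃ z, y i < z ∧ z < y (i+1) ∧ (q : ℝ[X]).eval z = 0 := by
      intro i
      exact sz_zero p q _ _ (hy _ _ (Nat.lt_succ_self _) i.2) (hp i i.2) (congrFun hq i)
    choose z hz1 hz2 hz3 using h1
    have hz : StrictMono z := by
      intro i j hij
      have hij' : (i:ℕ) + 1 ≤ j := hij
      have : y (i+1) ≤ y j := by
        rcases hij'.eq_or_lt with h | h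
        · rw [h]
        · exact (hy _ _ h j.2.le).le
      linarith [hz1 j, hz2 i]
    ext1
    by_contra hne
    have hne' : (q : ℝ[X]) ≠ 0 := hne
    have hdq := mem_degreeLT.1 q.2
    rw [degree_eq_natDegree hne'] at hdq
    have := Polynomial.card_roots' (q:ℝ[X])
    apply hne'
    apply Polynomial.eq_zero_of_natDegree_lt_card_of_eval_eq_zero (q:ℝ[X]) hz.injective hz3
    simpa using hdq
  have hfr : Module.finrank ℝ (degreeLT ℝ k) = Module.finrank ℝ (Fin k → ℝ) :=
    (degreeLTEquiv ℝ k).finrank_eq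
  haveI : FiniteDimensional ℝ (degreeLT ℝ k) := 
    (degreeLTEquiv ℝ k).symm.finiteDimensional
  have hsurj := (LinearMap.injective_iff_surjective_of_finrank_eq_finrank hfr).1 hinj
  obtain ⟨q, hq⟩ := hsurj (fun i => f i)
  exact ⟨q, mem_degreeLT.1 q.2, fun i hi => congrFun hq ⟨i, hi⟩⟩

lemma sz_intble (a b u v : ℝ) (w : ℝ → ℝ) (hw_mono : MonotoneOn w (Set.Icc a b))
    (hu : u ∈ Set.Icc a b) (hv : v ∈ Set.Icc a b) (g : ℝ → ℝ) (hg : Continuous g) :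
    IntervalIntegrable (fun x => g x * w x) MeasureTheory.volume u v := by
  have : IntervalIntegrable w MeasureTheory.volume u v :=
    (hw_mono.mono (Set.OrdConnected.uIcc_subset inferInstance hu hv)).intervalIntegrable
  exact this.continuousOn_mul hg.continuousOn

/-- no factor of constant sign -/
lemma sz_factor (a b : ℝ) (hab : a < b) (w : ℝ → ℝ)
    (hw_nonneg : ∀ x ∈ Set.Icc a b, 0 ≤ w x)
    (hw_mono : MonotoneOn w (Set.Icc a b))
    (k : ℕ) (p : Polynomial ℝ) (hp_ne : p ≠ 0) (hp_deg : p.natDegree = k)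
    (h_orth : ∀ q : Polynomial ℝ, q.natDegree < k →
      ∫ x in a..b, p.eval x * q.eval x * w x = 0)
    (h_norm : ∫ x in a..b, (p.eval x) ^ 2 * w x = 1)
    (m g : Polynomial ℝ) (hpm : p = m * g) (hm : 0 < m.natDegree)
    (hpos : ∀ x ∈ Set.Icc a b, 0 ≤ m.eval x) : False := by
  have hm0 : m ≠ 0 := by rintro rfl; simp at hm
  have hg0 : g ≠ 0 := by rintro rfl; simp at hpm; exact hp_ne hpm
  have hdeg : p.natDegree = m.natDegree + g.natDegree := by
    rw [hpm, Polynomial.natDegree_mul hm0 hg0]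
  have h1 := h_orth g (by omega)
  obtain ⟨K, hK⟩ := (isCompact_Icc (a := a) (b := b)).bddAbove_image (f := fun x => m.eval x)
    (by fun_prop)
  have ha : a ∈ Set.Icc a b := ⟨le_rfl, hab.le⟩
  have hb : b ∈ Set.Icc a b := ⟨hab.le, le_rfl⟩
  have h2 : ∫ x in a..b, (p.eval x) ^ 2 * w x ≤
      ∫ x in a..b, K * (p.eval x * g.eval x * w x) := by
    apply intervalIntegral.integral_mono_on hab.le
    · exact sz_intble a b a b w hw_mono ha hb _ (by fun_prop)
    · exact (sz_intble a b a b w hw_mono ha hb _ (by fun_prop)).const_mul _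
    · intro x hx
      have h3 : m.eval x ≤ K := hK ⟨x, hx, rfl⟩
      rw [hpm, Polynomial.eval_mul]
      have h4 : 0 ≤ m.eval x * g.eval x ^ 2 * w x :=
        mul_nonneg (mul_nonneg (hpos x hx) (sq_nonneg _)) (hw_nonneg x hx)
      nlinarith [mul_le_mul_of_nonneg_right h3 h4]
  rw [intervalIntegral.integral_const_mul, h1, h_norm] at h2
  linarith

open Polynomial in
lemma sz_roots (a b : ℝ) (k : ℕ) (p : Polynomial ℝ) (hp_ne : p ≠ 0) (hp_deg : p.natDegree = k)
    (hF : ∀ m g : Polynomial ℝ, p = m * g → 0 < m.natDegree →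
      (∀ x ∈ Set.Icc a b, 0 ≤ m.eval x) → False) :
    p.roots.toFinset.card = k ∧ ∀ x ∈ p.roots.toFinset, a < x ∧ x < b := by
  have hF' : ∀ m g : Polynomial ℝ, p = m * g → 0 < m.natDegree →
      (∀ x ∈ Set.Icc a b, m.eval x ≤ 0) → False := by
    intro m g h1 h2 h3
    apply hF (-m) (-g) (by rw [h1]; ring) (by simpa using h2)
    intro x hx
    simpa using h3 x hx
  have hsplit : p.Splits := by
    rw [splits_iff_splits]
    right
    intro g hg hgp
    by_contra hdeg
    have hnr : ∀ x, g.eval x ≠ 0 := by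
      intro x hx
      exact hdeg (degree_eq_one_of_irreducible_of_root hg hx)
    obtain ⟨h, hh⟩ := hgp
    have hgd := hg.natDegree_pos
    have hcon : (∀ x, 0 < g.eval x) ∨ (∀ x, g.eval x < 0) := by
      by_contra hcon
      push Not at hcon
      obtain ⟨⟨u, hu⟩, ⟨v, hv⟩⟩ := hcon
      have := mem_range_of_exists_le_of_exists_ge (f := fun x => g.eval x) (c := 0) (by fun_prop) ⟨u, hu⟩ ⟨v, hv⟩
      obtain ⟨x, hx⟩ := this
      exact hnr x hx
    rcases hcon with hcon | hcon
    · exact hF g h hh hgd (fun x _ => (hcon x).le)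
    · exact hF' g h hh hgd (fun x _ => (hcon x).le)
  have hnd : p.roots.Nodup := by
    rw [Multiset.nodup_iff_count_le_one]
    intro α
    by_contra hc
    push Not at hc
    rw [count_roots] at hc
    have : (X - C α)^2 ∣ p := (le_rootMultiplicity_iff hp_ne).1 hc
    obtain ⟨h, hh⟩ := this
    refine hF _ h hh (by simp) ?_
    intro x _
    simp only [eval_pow]
    positivity
  constructor
  · rw [Multiset.toFinset_card_of_nodup hnd, ← hp_deg]
    exact hsplit.natDegree_eq_card_roots.symm
  · intro x hx
    have hr : p.IsRoot x := by
      have := Multiset.mem_toFinset.1 hx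
      exact isRoot_of_mem_roots this
    obtain ⟨g, hg⟩ := dvd_iff_isRoot.2 hr
    constructor
    · by_contra h
      refine hF _ g hg (by simp) ?_
      intro t ht
      have := ht.1
      simp; linarith
    · by_contra h
      refine hF' _ g hg (by simp) ?_
      intro t ht
      have := ht.2
      simp; linarith

lemma sz_le (k : ℕ) (y : ℕ → ℝ) (hy : ∀ i j, i < j → j ≤ k → y i < y j) (i j : ℕ)
    (hij : i ≤ j) (hj : j ≤ k) : y i ≤ y j := by
  rcases hij.eq_or_lt with h | h
  · rw [h]
  · exact (hy _ _ h hj).le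

lemma sz_q (k j : ℕ) (hj : j < k) (p : Polynomial ℝ) (y : ℕ → ℝ)
    (hy : ∀ i j, i < j → j ≤ k → y i < y j) (c : ℝ)
    (hfac : ∀ x, p.eval x = c * ∏ i ∈ (Finset.range (k+1)).erase j, (x - y i))
    (hp : ∀ i < k, ∀ x, y i < x → x < y (i+1) → p.eval x ≠ 0)
    (hM : p.eval (y j) ≠ 0) :
    ∃ q : Polynomial ℝ, q.degree < k ∧
      (∀ i < k, ∫ x in (y i)..(y (i+1)), p.eval x * q.eval x =
        if i + 1 = j then -(p.eval (y j))^2/2 else 0) ∧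
      ∀ x, y k ≤ x → p.eval x * q.eval x ≤ 0 := by
  rcases Nat.eq_zero_or_pos j with h0 | h0
  · refine ⟨0, by simpa using WithBot.bot_lt_coe k, ?_, by simp⟩
    intro i _
    simp [h0]
  obtain ⟨e, rfl⟩ : ∃ e, j = e + 1 := ⟨j - 1, by omega⟩
  have hle := sz_le k y hy
  obtain ⟨q, hqd, hq⟩ := sz_exists k p y hy hp
    (fun i => if i + 1 = e + 1 then -(p.eval (y (e+1)))^2/2 else 0)
  refine ⟨q, hqd, hq, ?_⟩
  set T := ((Finset.range (k+1)).erase (e+1)) with hT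
  have heT : e ∈ T := by simp [hT]; omega
  -- zeros
  have hz : ∀ i, ∃ z, i ∈ T.erase e → q.eval z = 0 ∧
      ((i < e ∧ y i < z ∧ z < y (i+1)) ∨ (e + 1 < i ∧ y (i-1) < z ∧ z < y i)) := by
    intro i
    by_cases hi : i ∈ T.erase e
    · simp only [hT, Finset.mem_erase, Finset.mem_range] at hi
      rcases lt_or_ge i e with h | h
      · obtain ⟨z, h1, h2, h3⟩ := sz_zero p q (y i) (y (i+1)) (hy _ _ (by omega) (by omega))
          (hp i (by omega)) (by rw [hq i (by omega), if_neg (by omega)])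
        exact ⟨z, fun _ => ⟨h3, Or.inl ⟨h, h1, h2⟩⟩⟩
      · obtain ⟨i', rfl⟩ : ∃ e, i = e + 1 := ⟨i - 1, by omega⟩
        obtain ⟨z, h1, h2, h3⟩ := sz_zero p q (y i') (y (i'+1)) (hy _ _ (by omega) (by omega))
          (hp i' (by omega)) (by rw [hq i' (by omega), if_neg (by omega)])
        exact ⟨z, fun _ => ⟨h3, Or.inr ⟨by omega, h1, h2⟩⟩⟩
    · exact ⟨0, fun h => absurd h hi⟩
  choose ζ hζ using hz
  have hlt : ∀ i ∈ T.erase e, ∀ l ∈ T.erase e, i < l → ζ i < ζ l := by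
    intro i hi l hl hil
    have hl' := hl
    simp only [hT, Finset.mem_erase, Finset.mem_range] at hl'
    rcases (hζ i hi).2 with ⟨h1, h2, h3⟩ | ⟨h1, h2, h3⟩ <;>
    rcases (hζ l hl).2 with ⟨h4, h5, h6⟩ | ⟨h4, h5, h6⟩
    · linarith [hle (i+1) l (by omega) (by omega)]
    · linarith [hle (i+1) (l-1) (by omega) (by omega)]
    · omega
    · linarith [hle i (l-1) (by omega) (by omega)]
  have hinj : Set.InjOn ζ (T.erase e) := by
    intro i hi l hl h
    rcases lt_trichotomy i l with h' | h' | h'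
    · exact absurd h (hlt i hi l hl h').ne
    · exact h'
    · exact absurd h (hlt l hl i hi h').ne'
  have hcard : (T.erase e).card = k - 1 := by
    rw [Finset.card_erase_of_mem heT, hT, Finset.card_erase_of_mem (by simp; omega)]
    simp
  have hqn : q.natDegree ≤ k - 1 := by
    have : q.natDegree < k := by
      by_cases h : q = 0
      · simp [h]; omega
      · exact (Polynomial.natDegree_lt_iff_degree_lt h).2 hqd
    omega
  obtain ⟨c', hc'⟩ := sz_fac (T.erase e) ζ hinj q (by omega) (fun i hi => (hζ i hi).1)
  have hprod : ∀ x, p.eval x * q.eval x =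
      (c * c') * ((x - y e) * ∏ i ∈ T.erase e, ((x - y i) * (x - ζ i))) := by
    intro x
    rw [hfac, hc', ← Finset.mul_prod_erase T _ heT, Finset.prod_mul_distrib]
    ring
  have hC : c * c' ≤ 0 := by
    by_contra hneg
    push Not at hneg
    have h1 := hq e (by omega)
    rw [if_pos rfl] at h1
    have h2 : 0 ≤ ∫ x in (y e)..(y (e+1)), p.eval x * q.eval x := by
      apply intervalIntegral.integral_nonneg (hle _ _ (by omega) (by omega))
      intro x hx
      rw [hprod]
      refine mul_nonneg hneg.le (mul_nonneg (by linarith [hx.1]) (Finset.prod_nonneg ?_))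
      intro i hi
      have hi' := hi
      simp only [hT, Finset.mem_erase, Finset.mem_range] at hi'
      rcases (hζ i hi).2 with ⟨h1, h2, h3⟩ | ⟨h1, h2, h3⟩
      · have := hle (i+1) e (by omega) (by omega)
        exact mul_nonneg (by linarith [hx.1]) (by linarith [hx.1])
      · have := hle (e+1) (i-1) (by omega) (by omega)
        exact mul_nonneg_of_nonpos_of_nonpos (by linarith [hx.2]) (by linarith [hx.2])
    have : 0 < (p.eval (y (e+1)))^2 := by positivity
    linarith
  intro x hx
  rw [hprod]
  refine mul_nonpos_of_nonpos_of_nonneg hC (mul_nonneg ?_ (Finset.prod_nonneg ?_))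
  · linarith [hle e k (by omega) le_rfl]
  intro i hi
  have hi' := hi
  simp only [hT, Finset.mem_erase, Finset.mem_range] at hi'
  have hik := hle i k (by omega) le_rfl
  refine mul_nonneg (by linarith) ?_
  rcases (hζ i hi).2 with ⟨h1, h2, h3⟩ | ⟨h1, h2, h3⟩
  · have := hle (i+1) k (by omega) le_rfl
    linarith
  · linarith

lemma sz_core (a b : ℝ) (w : ℝ → ℝ)
    (hw_nonneg : ∀ x ∈ Set.Icc a b, 0 ≤ w x)
    (hw_mono : MonotoneOn w (Set.Icc a b))
    (k j : ℕ) (hj : j < k) (p : Polynomial ℝ) (hpd : p.natDegree = k) (y : ℕ → ℝ)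
    (hy : ∀ i j, i < j → j ≤ k → y i < y j) (hya : a ≤ y 0) (hyb : y k ≤ b) (c : ℝ)
    (hfac : ∀ x, p.eval x = c * ∏ i ∈ (Finset.range (k+1)).erase j, (x - y i))
    (hp : ∀ i < k, ∀ x, y i < x → x < y (i+1) → p.eval x ≠ 0)
    (hM : p.eval (y j) ≠ 0)
    (h_orth : ∀ q : Polynomial ℝ, q.natDegree < k →
      ∫ x in a..b, p.eval x * q.eval x * w x = 0) :
    w (y j) * (p.eval (y j)) ^ 2 ≤ w b * (p.eval b) ^ 2 := by
  have hle := sz_le k y hy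
  have hmem : ∀ i ≤ k, y i ∈ Set.Icc a b := fun i hi =>
    ⟨hya.trans (hle 0 i (by omega) hi), (hle i k hi le_rfl).trans hyb⟩
  have hk0 := hmem k le_rfl
  have hamem : a ∈ Set.Icc a b := ⟨le_rfl, hk0.1.trans hk0.2⟩
  have hbmem : b ∈ Set.Icc a b := ⟨hk0.1.trans hk0.2, le_rfl⟩
  obtain ⟨q, hqd, hq, hqs⟩ := sz_q k j hj p y hy c hfac hp hM
  set T := ((Finset.range (k+1)).erase j) with hT
  have hkT : k ∈ T := by simp [hT]; omega
  have hroot : ∀ i ≤ k, i ≠ j → p.eval (y i) = 0 := by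
    intro i hi hij
    rw [hfac, Finset.prod_eq_zero (i := i)]
    · simp
    · simp [hT, hij]; omega
    · simp
  have hder : ∀ u v : ℝ, ∫ x in u..v, p.eval x * p.derivative.eval x =
      (p.eval v ^ 2 - p.eval u ^ 2) / 2 := by
    intro u v
    have := intervalIntegral.integral_eq_sub_of_hasDerivAt (a := u) (b := v)
      (f := fun x => p.eval x ^ 2 / 2) (f' := fun x => p.eval x * p.derivative.eval x)
      (fun x _ => by
        have h := ((p.hasDerivAt x).pow 2).div_const 2
        exact h.congr_deriv (by norm_num; ring)) (Continuous.intervalIntegrable (by fun_prop) _ _)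
    rw [this]; ring
  set M := p.eval (y j) ^ 2 with hMdef
  have hMpos : 0 < M := by positivity
  obtain ⟨r, hrdef⟩ : ∃ r, r = q + p.derivative := ⟨_, rfl⟩
  have hrint : ∀ u v : ℝ, ∫ x in u..v, p.eval x * r.eval x =
      (∫ x in u..v, p.eval x * q.eval x) + (p.eval v ^ 2 - p.eval u ^ 2) / 2 := by
    intro u v
    rw [← hder, ← intervalIntegral.integral_add]
    · congr 1
      ext x
      rw [hrdef, Polynomial.eval_add]; ring
    all_goals exact Continuous.intervalIntegrable (by fun_prop) _ _
  have hr : ∀ i < k, ∫ x in (y i)..(y (i+1)), p.eval x * r.eval x =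
      if i = j then -M/2 else 0 := by
    intro i hi
    rw [hrint, hq i hi]
    by_cases h1 : i = j
    · rw [if_pos h1, if_neg (by omega), hroot (i+1) (by omega) (by omega), h1]
      ring
    · rw [if_neg h1, hroot i (by omega) h1]
      by_cases h2 : i + 1 = j
      · rw [if_pos h2, h2]; ring
      · rw [if_neg h2, hroot (i+1) (by omega) h2]; ring
  have hrn : r.natDegree ≤ k - 1 := by
    have h1 : q.natDegree < k := by
      by_cases h : q = 0
      · simp [h]; omega
      · exact (Polynomial.natDegree_lt_iff_degree_lt h).2 hqd
    have h2 := p.natDegree_derivative_le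
    have h3 := Polynomial.natDegree_add_le q p.derivative
    rw [← hrdef] at h3
    omega
  have hz : ∀ i, ∃ z, i ∈ T.erase k → r.eval z = 0 ∧ y i < z ∧ z < y (i+1) := by
    intro i
    by_cases hi : i ∈ T.erase k
    · simp only [hT, Finset.mem_erase, Finset.mem_range] at hi
      obtain ⟨z, h1, h2, h3⟩ := sz_zero p r (y i) (y (i+1)) (hy _ _ (by omega) (by omega))
          (hp i (by omega)) (by rw [hr i (by omega), if_neg (by omega)])
      exact ⟨z, fun _ => ⟨h3, h1, h2⟩⟩
    · exact ⟨0, fun h => absurd h hi⟩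
  choose ζ hζ using hz
  have hlt : ∀ i ∈ T.erase k, ∀ l ∈ T.erase k, i < l → ζ i < ζ l := by
    intro i hi l hl hil
    have hl' := hl
    simp only [hT, Finset.mem_erase, Finset.mem_range] at hl'
    linarith [hle (i+1) l (by omega) (by omega), (hζ i hi).2.2, (hζ l hl).2.1]
  have hinj : Set.InjOn ζ (T.erase k) := by
    intro i hi l hl h
    rcases lt_trichotomy i l with h' | h' | h'
    · exact absurd h (hlt i hi l hl h').ne
    · exact h'
    · exact absurd h (hlt l hl i hi h').ne'
  have hcard : (T.erase k).card = k - 1 := by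
    rw [Finset.card_erase_of_mem hkT, hT, Finset.card_erase_of_mem (by simp; omega)]
    simp
  obtain ⟨c', hc'⟩ := sz_fac (T.erase k) ζ hinj r (by omega) (fun i hi => (hζ i hi).1)
  have hprod : ∀ x, p.eval x * r.eval x =
      (c * c') * ((x - y k) * ∏ i ∈ T.erase k, ((x - y i) * (x - ζ i))) := by
    intro x
    rw [hfac, hc', ← Finset.mul_prod_erase T _ hkT, Finset.prod_mul_distrib]
    ring
  -- pair positivity
  have hpair : ∀ m ≤ k, ∀ x, (m = 0 ∨ y (m-1) ≤ x) → (m = k + 1 ∨ x ≤ y m) →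
      ∀ i ∈ T.erase k, i + 1 ≠ m → 0 ≤ (x - y i) * (x - ζ i) := by
    intro m hm x hx1 hx2 i hi him
    have hi' := hi
    simp only [hT, Finset.mem_erase, Finset.mem_range] at hi'
    obtain ⟨-, h1, h2⟩ := hζ i hi
    have hx2' : x ≤ y m := hx2.resolve_left (by omega)
    rcases lt_or_ge (i+1) m with h | h
    · have h3 := hx1.resolve_left (by omega)
      have := hle (i+1) (m-1) (by omega) (by omega)
      exact mul_nonneg (by linarith) (by linarith)
    · have := hle m i (by omega) (by omega)
      exact mul_nonneg_of_nonpos_of_nonpos (by linarith) (by linarith)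
  have hnegj : ∀ x, y j ≤ x → x ≤ y (j+1) →
      (x - y k) * ∏ i ∈ T.erase k, ((x - y i) * (x - ζ i)) ≤ 0 := by
    intro x h1 h2
    refine mul_nonpos_of_nonpos_of_nonneg ?_ (Finset.prod_nonneg ?_)
    · linarith [hle (j+1) k (by omega) le_rfl]
    · intro i hi
      refine hpair (j+1) (by omega) x (Or.inr (by simpa using h1)) (Or.inr h2) i hi ?_
      simp only [hT, Finset.mem_erase, Finset.mem_range] at hi
      omega
  have hC : 0 ≤ c * c' := by
    by_contra hneg
    push Not at hneg
    have h1 := hr j hj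
    rw [if_pos rfl] at h1
    have h2 : 0 ≤ ∫ x in (y j)..(y (j+1)), p.eval x * r.eval x := by
      apply intervalIntegral.integral_nonneg (hle _ _ (by omega) (by omega))
      intro x hx
      rw [hprod]
      exact mul_nonneg_of_nonpos_of_nonpos hneg.le (hnegj x hx.1 hx.2)
    linarith
  have hI : ∀ u ∈ Set.Icc a b, ∀ v ∈ Set.Icc a b, IntervalIntegrable
      (fun x => p.eval x * r.eval x * w x) MeasureTheory.volume u v := fun u hu v hv =>
    sz_intble a b u v w hw_mono hu hv _ (by fun_prop)
  -- comparison
  have hcmp : ∀ u ∈ Set.Icc a b, ∀ v ∈ Set.Icc a b, u ≤ v → ∀ W : ℝ,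
      (∀ x ∈ Set.Icc u v, p.eval x * r.eval x * w x ≤ W * (p.eval x * r.eval x)) →
      ∫ x in u..v, p.eval x * r.eval x * w x ≤ W * ∫ x in u..v, p.eval x * r.eval x := by
    intro u hu v hv huv W h
    rw [← intervalIntegral.integral_const_mul]
    apply intervalIntegral.integral_mono_on huv (hI u hu v hv) _ h
    exact Continuous.intervalIntegrable (by fun_prop) _ _
  have hleft : ∫ x in a..(y 0), p.eval x * r.eval x * w x ≤ 0 := by
    have := hcmp a hamem (y 0) (hmem 0 (by omega)) hya 0 (by
      intro x hx
      rw [zero_mul, hprod]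
      have hxm : x ∈ Set.Icc a b := ⟨hx.1, hx.2.trans (hmem 0 (by omega)).2⟩
      refine mul_nonpos_of_nonpos_of_nonneg ?_ (hw_nonneg x hxm)
      refine mul_nonpos_of_nonneg_of_nonpos hC ?_
      refine mul_nonpos_of_nonpos_of_nonneg ?_ (Finset.prod_nonneg ?_)
      · linarith [hle 0 k (by omega) le_rfl, hx.2]
      · intro i hi
        exact hpair 0 (by omega) x (Or.inl rfl) (Or.inr hx.2) i hi (by omega))
    simpa using this
  have hmid : ∀ i < k, ∫ x in (y i)..(y (i+1)), p.eval x * r.eval x * w x ≤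
      if i = j then -(w (y j) * M/2) else 0 := by
    intro m hm
    have hm1 := hmem m (by omega)
    have hm2 := hmem (m+1) (by omega)
    have hmm := hle m (m+1) (by omega) (by omega)
    by_cases h : m = j
    · subst h
      rw [if_pos rfl]
      have := hcmp _ hm1 _ hm2 hmm (w (y m)) (by
        intro x hx
        have h1 : p.eval x * r.eval x ≤ 0 := by
          rw [hprod]
          exact mul_nonpos_of_nonneg_of_nonpos hC (hnegj x hx.1 hx.2)
        have h2 := hw_mono hm1 ⟨hm1.1.trans hx.1, hx.2.trans hm2.2⟩ hx.1
        nlinarith)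
      rw [hr m hm, if_pos rfl] at this
      linarith
    · rw [if_neg h]
      have hmT : m ∈ T.erase k := by
        simp only [hT, Finset.mem_erase, Finset.mem_range]; omega
      obtain ⟨-, hz1, hz2⟩ := hζ m hmT
      have := hcmp _ hm1 _ hm2 hmm (w (ζ m)) (by
        intro x hx
        have hxm : x ∈ Set.Icc a b := ⟨hm1.1.trans hx.1, hx.2.trans hm2.2⟩
        have hzm : ζ m ∈ Set.Icc a b := ⟨hm1.1.trans hz1.le, hz2.le.trans hm2.2⟩
        have h1 : 0 ≤ (x - ζ m) * (w x - w (ζ m)) := by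
          rcases le_total x (ζ m) with h | h
          · have := hw_mono hxm hzm h
            exact mul_nonneg_of_nonpos_of_nonpos (by linarith) (by linarith)
          · have := hw_mono hzm hxm h
            exact mul_nonneg (by linarith) (by linarith)
        have h2 : 0 ≤ ∏ i ∈ (T.erase k).erase m, ((x - y i) * (x - ζ i)) := by
          refine Finset.prod_nonneg ?_
          intro i hi
          refine hpair (m+1) (by omega) x (Or.inr (by simpa using hx.1)) (Or.inr hx.2) i
            (Finset.mem_of_mem_erase hi) ?_
          have := Finset.ne_of_mem_erase hi
          omega
        have h3 : x ≤ y k := hx.2.trans (hle (m+1) k (by omega) le_rfl)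
        rw [hprod, ← Finset.mul_prod_erase _ _ hmT]
        have h4 := mul_nonneg (mul_nonneg hC (mul_nonneg (sub_nonneg.2 h3) (sub_nonneg.2 hx.1)))
          (mul_nonneg h1 h2)
        linarith)
      rw [hr m hm, if_neg h] at this
      simpa using this
  have hright : ∫ x in (y k)..b, p.eval x * r.eval x * w x ≤ w b * (p.eval b ^ 2 / 2) := by
    have h1 := hcmp (y k) hk0 b hbmem hk0.2 (w b) (by
      intro x hx
      have hxm : x ∈ Set.Icc a b := ⟨hk0.1.trans hx.1, hx.2⟩
      have h2 := hw_mono hxm hbmem hx.2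
      have h3 : 0 ≤ p.eval x * r.eval x := by
        rw [hprod]
        refine mul_nonneg hC (mul_nonneg (by linarith [hx.1]) (Finset.prod_nonneg ?_))
        intro i hi
        obtain ⟨-, hz1, hz2⟩ := hζ i hi
        simp only [hT, Finset.mem_erase, Finset.mem_range] at hi
        have := hle (i+1) k (by omega) le_rfl
        exact mul_nonneg (by linarith [hx.1]) (by linarith [hx.1])
      nlinarith)
    refine h1.trans (mul_le_mul_of_nonneg_left ?_ (hw_nonneg b hbmem))
    rw [hrint, hroot k le_rfl (by omega)]
    have h4 : ∫ x in (y k)..b, p.eval x * q.eval x ≤ 0 := by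
      have := intervalIntegral.integral_nonneg (μ := MeasureTheory.volume) hk0.2
        (f := fun x => -(p.eval x * q.eval x))
        (fun x hx => by linarith [hqs x hx.1])
      rw [intervalIntegral.integral_neg] at this
      linarith
    linarith
  have hsum := intervalIntegral.sum_integral_adjacent_intervals (μ := MeasureTheory.volume)
    (f := fun x => p.eval x * r.eval x * w x) (a := y) (n := k)
    (fun i hi => hI _ (hmem i hi.le) _ (hmem (i+1) hi))
  have hbd := Finset.sum_le_sum (s := Finset.range k) (fun i hi => hmid i (Finset.mem_range.1 hi))
  rw [hsum, Finset.sum_ite_eq', if_pos (Finset.mem_range.2 hj)] at hbd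
  have h0 := h_orth r (by omega)
  rw [← intervalIntegral.integral_add_adjacent_intervals (hI a hamem (y k) hk0) (hI _ hk0 b hbmem),
    ← intervalIntegral.integral_add_adjacent_intervals (hI a hamem (y 0) (hmem 0 (by omega)))
      (hI _ (hmem 0 (by omega)) _ hk0)] at h0
  linarith

theorem szego_weighted_poly_max_at_right_endpoint
    (a b : ℝ) (hab : a < b) (w : ℝ → ℝ)
    (hw_nonneg : ∀ x ∈ Set.Icc a b, 0 ≤ w x)
    (hw_mono : MonotoneOn w (Set.Icc a b))
    (hw_int : 0 < ∫ x in a..b, w x)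
    (k : ℕ) (p : Polynomial ℝ) (hp_ne : p ≠ 0) (hp_deg : p.natDegree = k)
    (h_orth : ∀ q : Polynomial ℝ, q.natDegree < k →
      ∫ x in a..b, p.eval x * q.eval x * w x = 0)
    (h_norm : ∫ x in a..b, (p.eval x) ^ 2 * w x = 1) :
    ∀ x ∈ Set.Icc a b, w x * (p.eval x) ^ 2 ≤ w b * (p.eval b) ^ 2 := by
  classical
  intro ξ hξ
  have hbmem : b ∈ Set.Icc a b := ⟨hab.le, le_rfl⟩
  obtain ⟨hcard, hin⟩ := sz_roots a b k p hp_ne hp_deg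
    (sz_factor a b hab w hw_nonneg hw_mono k p hp_ne hp_deg h_orth h_norm)
  by_cases hξ0 : p.eval ξ = 0
  · rw [hξ0]
    have := mul_nonneg (hw_nonneg b hbmem) (sq_nonneg (p.eval b))
    simpa using this
  have hmemroot : ∀ x, x ∈ p.roots.toFinset ↔ p.eval x = 0 := by
    intro x
    rw [Multiset.mem_toFinset, Polynomial.mem_roots hp_ne, Polynomial.IsRoot.def]
  set R := p.roots.toFinset with hR
  have hξR : ξ ∉ R := by rw [hmemroot]; exact hξ0
  have hScard : (insert ξ R).card = k + 1 := by rw [Finset.card_insert_of_notMem hξR, hcard]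
  set emb := (insert ξ R).orderEmbOfFin hScard with hemb
  obtain ⟨y, hydef⟩ : ∃ y : ℕ → ℝ, ∀ i (h : i < k + 1), y i = emb ⟨i, h⟩ :=
    ⟨fun i => if h : i < k + 1 then emb ⟨i, h⟩ else 0, fun i h => by simp [h]⟩
  have hy : ∀ i j, i < j → j ≤ k → y i < y j := by
    intro i j hij hj
    rw [hydef i (by omega), hydef j (by omega)]
    exact emb.strictMono hij
  have hyS : ∀ i ≤ k, y i ∈ insert ξ R := by
    intro i hi
    rw [hydef i (by omega)]
    exact Finset.orderEmbOfFin_mem _ _ _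
  have hSy : ∀ x ∈ insert ξ R, ∃ i ≤ k, y i = x := by
    intro x hx
    have : x ∈ Set.range emb := by
      rw [hemb, Finset.range_orderEmbOfFin]; exact hx
    obtain ⟨i, hi⟩ := this
    exact ⟨i, by omega, by rw [hydef i i.2]; exact hi⟩
  have hle := sz_le k y hy
  obtain ⟨j, hjk, hj⟩ := hSy ξ (Finset.mem_insert_self _ _)
  have hyroot : ∀ i ≤ k, i ≠ j → p.eval (y i) = 0 := by
    intro i hi hij
    rcases Finset.mem_insert.1 (hyS i hi) with h | h
    · exfalso
      rw [← hj] at h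
      rcases lt_or_gt_of_ne hij with h' | h'
      · exact absurd h (hy _ _ h' hjk).ne
      · exact absurd h (hy _ _ h' hi).ne'
    · exact (hmemroot _).1 h
  have hinj : Set.InjOn y ((Finset.range (k+1)).erase j) := by
    intro i hi l hl h
    simp only [Finset.coe_erase, Finset.coe_range, Set.mem_diff, Set.mem_Iio] at hi hl
    rcases lt_trichotomy i l with h' | h' | h'
    · exact absurd h (hy _ _ h' (by omega)).ne
    · exact h'
    · exact absurd h (hy _ _ h' (by omega)).ne'
  obtain ⟨c, hc⟩ := sz_fac ((Finset.range (k+1)).erase j) y hinj p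
    (by rw [Finset.card_erase_of_mem (by simp; omega)]; simp [hp_deg])
    (fun i hi => by
      simp only [Finset.mem_erase, Finset.mem_range] at hi
      exact hyroot i (by omega) hi.1)
  have hrange : ∀ i ≤ k, y i ∈ Set.Icc a b := by
    intro i hi
    rcases Finset.mem_insert.1 (hyS i hi) with h | h
    · rw [h]; exact hξ
    · exact ⟨(hin _ h).1.le, (hin _ h).2.le⟩
  rcases hjk.eq_or_lt with h | h
  · -- all roots to the left
    have h1 : p.eval ξ ^ 2 ≤ p.eval b ^ 2 := by
      rw [hc, hc, mul_pow, mul_pow, ← Finset.prod_pow, ← Finset.prod_pow]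
      refine mul_le_mul_of_nonneg_left (Finset.prod_le_prod (fun i _ => sq_nonneg _) ?_)
        (sq_nonneg _)
      intro i hi
      simp only [Finset.mem_erase, Finset.mem_range] at hi
      have h2 := hle i j (by omega) hjk
      rw [hj] at h2
      have h3 := hξ.2
      exact pow_le_pow_left₀ (by linarith) (by linarith) 2
    exact mul_le_mul (hw_mono hξ hbmem hξ.2) h1 (sq_nonneg _) (hw_nonneg b hbmem)
  · have := sz_core a b w hw_nonneg hw_mono k j h p hp_deg y hy (hrange 0 (by omega)).1
      (hrange k le_rfl).2 c hc (by
        intro i hi x h1 h2 h3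
        obtain ⟨l, hl, rfl⟩ := hSy x (Finset.mem_insert_of_mem ((hmemroot x).2 h3))
        rcases le_or_gt l i with h4 | h4
        · exact absurd h1 (not_lt.2 (hle _ _ h4 (by omega)))
        · exact absurd h2 (not_lt.2 (hle _ _ h4 (by omega)))) (by rw [hj]; exact hξ0) h_orth
    rwa [hj] at this
end
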